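/- Let A be an n-dimensional algebra with lev(A) = m > 2 and G(A) = 1, and suppose that for every 1-dimensional subalgebra A_0 of A, the IW contraction of A with respect to A_0 has level at most 1. Then n ≥ 2m+1 and A can be represented by the structure η_m ⊕ k^{n−2m−1}. -/

import Mathlib

open scoped BigOperators

noncomputable section

/-- The space of `n`-dimensional (nonassociative) algebra structures on `kⁿ`:
bilinear maps `kⁿ × kⁿ → kⁿ`. -/
abbrev AlgStr (k : Type*) [Field k] (n : ℕ) : Type _ :=
  (Fin n → k) →ₗ[k] (Fin n → k) →ₗ[k] (Fin n → k)

variable {k : Type*} [Field k]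

/-- The algebra structure with prescribed structure constants `c`:
`μ(x, y) m = ∑ i, ∑ j, x i * y j * c i j m`. -/
def ofConst {n : ℕ} (c : Fin n → Fin n → Fin n → k) : AlgStr k n :=
  ∑ i, ∑ j,
    ((LinearMap.mul k k).compl₁₂ (LinearMap.proj i) (LinearMap.proj j)).compr₂
      (LinearMap.toSpanSingleton k (Fin n → k) (c i j))

/-- The structure constants of an algebra structure in the standard basis. -/
def structConst {n : ℕ} (μ : AlgStr k n) : Fin n × Fin n × Fin n → k :=
  fun t => μ (Pi.single t.1 1) (Pi.single t.2.1 1) t.2.2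

/-- A subset of `AlgStr k n` is Zariski closed if it is the common zero locus of a
family of polynomials in the structure constants. -/
def IsZariskiClosed {n : ℕ} (S : Set (AlgStr k n)) : Prop :=
  ∃ P : Set (MvPolynomial (Fin n × Fin n × Fin n) k),
    ∀ μ : AlgStr k n, μ ∈ S ↔ ∀ p ∈ P, MvPolynomial.eval (structConst μ) p = 0

/-- The action of `GL(V)` on algebra structures: `(g • μ)(x,y) = g (μ (g⁻¹ x) (g⁻¹ y))`. -/
def transport {n : ℕ} (g : (Fin n → k) ≃ₗ[k] (Fin n → k)) (μ : AlgStr k n) :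
    AlgStr k n :=
  ((μ.comp g.symm.toLinearMap).compl₂ g.symm.toLinearMap).compr₂ g.toLinearMap

/-- The `GL(V)`-orbit of an algebra structure; two structures represent isomorphic
algebras iff they lie in the same orbit. -/
def orbit {n : ℕ} (μ : AlgStr k n) : Set (AlgStr k n) :=
  {χ | ∃ g : (Fin n → k) ≃ₗ[k] (Fin n → k), transport g μ = χ}

/-- The Zariski closure of a set of algebra structures. -/
def zclosure {n : ℕ} (S : Set (AlgStr k n)) : Set (AlgStr k n) :=
  {χ | ∀ T : Set (AlgStr k n), IsZariskiClosed T → S ⊆ T → χ ∈ T}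

/-- `μ` degenerates to `χ` if `χ` lies in the Zariski closure of the orbit of `μ`. -/
def degenerates {n : ℕ} (μ χ : AlgStr k n) : Prop :=
  χ ∈ zclosure (orbit μ)

/-- A proper degeneration: additionally `χ` is not isomorphic to `μ`. -/
def properlyDegenerates {n : ℕ} (μ χ : AlgStr k n) : Prop :=
  degenerates μ χ ∧ χ ∉ orbit μ

/-- There is a chain of `m` proper degenerations starting at `μ`. -/
def hasChain {n : ℕ} (μ : AlgStr k n) (m : ℕ) : Prop :=
  ∃ c : ℕ → AlgStr k n, c m = μ ∧ ∀ i < m, properlyDegenerates (c (i + 1)) (c i)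

/-- The level of `μ` is `m`: there is a chain of `m` proper degenerations starting
at `μ` but no chain of `m+1`. -/
def levelIs {n : ℕ} (μ : AlgStr k n) (m : ℕ) : Prop :=
  hasChain μ m ∧ ¬ hasChain μ (m + 1)

/-- The subalgebra generated by a set `s`. -/
def subalgGen {n : ℕ} (μ : AlgStr k n) (s : Set (Fin n → k)) :
    Submodule k (Fin n → k) :=
  sInf {W | s ⊆ W ∧ ∀ x ∈ W, ∀ y ∈ W, μ x y ∈ W}

/-- The generation type of `μ` is `m`: `m` is the maximal dimension of a
one-generated subalgebra. -/
def genType {n : ℕ} (μ : AlgStr k n) (m : ℕ) : Prop :=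
  IsGreatest {d : ℕ | ∃ a : Fin n → k, Module.finrank k ↥(subalgGen μ {a}) = d} m

/-- A standard `1`-generated algebra: it admits a grading `A = ⊕_{i ≥ 1} A_i` with
`dim A_1 = 1`, `A_i A_j ⊆ A_{i+j}`, generated by `A_1` as an algebra. -/
def StandardOneGenerated {m : ℕ} (μ : AlgStr k m) : Prop :=
  ∃ A : ℕ → Submodule k (Fin m → k),
    A 0 = ⊥ ∧ DirectSum.IsInternal A ∧ Module.finrank k ↥(A 1) = 1 ∧
    (∀ i j : ℕ, ∀ x ∈ A i, ∀ y ∈ A j, μ x y ∈ A (i + j)) ∧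
    subalgGen μ ((A 1 : Submodule k (Fin m → k)) : Set (Fin m → k)) = ⊤

/-- Extension by zero of coordinates, `kᵐ → kⁿ`. -/
def inclMap (k : Type*) [Field k] {m n : ℕ} (h : m ≤ n) :
    (Fin m → k) →ₗ[k] (Fin n → k) where
  toFun x i := if hi : (i : ℕ) < m then x ⟨i, hi⟩ else 0
  map_add' x y := by funext i; by_cases hi : (i : ℕ) < m <;> simp [hi]
  map_smul' a x := by funext i; by_cases hi : (i : ℕ) < m <;> simp [hi]

/-- The `n`-dimensional algebra `B ⊕ k^{n-m}` obtained from an `m`-dimensional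
algebra `B` by adjoining a complement with all products zero. -/
def extendZero {m n : ℕ} (h : m ≤ n) (B : AlgStr k m) : AlgStr k n :=
  ((B.comp (LinearMap.funLeft k k (Fin.castLE h))).compl₂
      (LinearMap.funLeft k k (Fin.castLE h))).compr₂ (inclMap k h)

/-- The `i`-th standard basis vector (as a plain function, `0` if `i ≥ n`). -/
def unitVec {k : Type*} [Field k] (n i : ℕ) : Fin n → k :=
  fun j => if (j : ℕ) = i then 1 else 0

/-- Projection onto the coordinate `0` part. -/
def proj0 (k : Type*) [Field k] (n : ℕ) : (Fin n → k) →ₗ[k] (Fin n → k) :=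
  LinearMap.pi fun i => if (i : ℕ) = 0 then LinearMap.proj i else 0

/-- Projection onto the coordinates `≥ 1` part. -/
def projPos (k : Type*) [Field k] (n : ℕ) : (Fin n → k) →ₗ[k] (Fin n → k) :=
  LinearMap.pi fun i => if (i : ℕ) = 0 then 0 else LinearMap.proj i

/-- The Inönü–Wigner contraction of `μ` with respect to the `1`-dimensional
subalgebra spanned by the first basis vector (the remaining coordinates form the
square-zero ideal part). -/
def IWcontract0 {n : ℕ} (μ : AlgStr k n) : AlgStr k n :=
  ((μ.comp (projPos k n)).compl₂ (proj0 k n)).compr₂ (projPos k n) +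
    ((μ.comp (proj0 k n)).compl₂ (projPos k n)).compr₂ (projPos k n) +
    (μ.comp (proj0 k n)).compl₂ (proj0 k n)

/-- The annihilator of an algebra structure. -/
def annihilator {n : ℕ} (μ : AlgStr k n) : Submodule k (Fin n → k) where
  carrier := {a | ∀ b, μ a b = 0 ∧ μ b a = 0}
  add_mem' := by
    intro a b ha hb
    intro c
    constructor
    · rw [map_add, LinearMap.add_apply, (ha c).1, (hb c).1, add_zero]
    · rw [map_add, (ha c).2, (hb c).2, add_zero]
  zero_mem' := by
    intro b
    constructor
    · rw [map_zero, LinearMap.zero_apply]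
    · rw [map_zero]
  smul_mem' := by
    intro t a ha b
    constructor
    · rw [map_smul, LinearMap.smul_apply, (ha b).1, smul_zero]
    · rw [map_smul, (ha b).2, smul_zero]

/-- `μ` has a square-zero (two-sided) ideal of codimension `1`. -/
def hasSqZeroIdealCodim1 {n : ℕ} (μ : AlgStr k n) : Prop :=
  ∃ I : Submodule k (Fin n → k), Module.finrank k ↥I = n - 1 ∧
    (∀ x ∈ I, ∀ y : Fin n → k, μ x y ∈ I ∧ μ y x ∈ I) ∧
    ∀ x ∈ I, ∀ y ∈ I, μ x y = 0

/-- `a` (viewed as the sequence of parts `a 0 ≥ a 1 ≥ …`) is a partition of `N`. -/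
def IsPartitionOf (a : ℕ → ℕ) (N : ℕ) : Prop :=
  (∀ i j : ℕ, i ≤ j → a j ≤ a i) ∧
    ∃ l : ℕ, (∀ i, l ≤ i → a i = 0) ∧ ∑ i ∈ Finset.range l, a i = N

/-- The dominance order on partitions: `a ⪰ b`. -/
def Dominates (a b : ℕ → ℕ) : Prop :=
  ∀ m : ℕ, ∑ i ∈ Finset.range m, b i ≤ ∑ i ∈ Finset.range m, a i

/-- `a` is the Jordan type of the matrix `M` at the eigenvalue `lam`:
`a` is a partition of the generalized eigenspace dimension, and the parts of `a`
are the sizes of the Jordan blocks of `M` with eigenvalue `lam`, expressed via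
the ranks of powers of `M - lam • 1`. -/
def IsJordanTypeAt {N : ℕ} (M : Matrix (Fin N) (Fin N) k) (lam : k) (a : ℕ → ℕ) :
    Prop :=
  IsPartitionOf a (N - ((M - lam • (1 : Matrix (Fin N) (Fin N) k)) ^ N).rank) ∧
    ∀ p : ℕ, ((M - lam • (1 : Matrix (Fin N) (Fin N) k)) ^ p).rank =
      N - ∑ i ∈ Finset.range N, min (a i) p

/-- The full specter of `M` is `{(lam i, a i)}`: the `lam i` are pairwise distinct,
each `a i` is the (nonempty) Jordan type of `M` at `lam i`, and every eigenvalue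
of `M` occurs among the `lam i`. -/
def IsFullSpecter {N : ℕ} (M : Matrix (Fin N) (Fin N) k) {l : ℕ}
    (lam : Fin l → k) (a : Fin l → ℕ → ℕ) : Prop :=
  Function.Injective lam ∧
    (∀ i, IsJordanTypeAt M (lam i) (a i) ∧ a i 0 ≠ 0) ∧
    ∀ c : k, (∃ v : Fin N → k, v ≠ 0 ∧ M.mulVec v = c • v) → ∃ i, lam i = c

/-- There is a chain of `len` strict dominance steps of partitions of `N`
starting (on top) at `a`. -/
def partChain (a : ℕ → ℕ) (N len : ℕ) : Prop :=
  ∃ c : ℕ → ℕ → ℕ, (∀ i ≤ len, IsPartitionOf (c i) N) ∧ c len = a ∧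
    ∀ i < len, Dominates (c (i + 1)) (c i) ∧ c (i + 1) ≠ c i

/-- The structure `T_α^M ∈ A_{m+1}`. -/
def Tstr {m : ℕ} (α : k) (M : Matrix (Fin m) (Fin m) k) : AlgStr k (m + 1) :=
  ofConst fun i j mm =>
    if hi : i = 0 then
      if hj : j = 0 then (if mm = 0 then α else 0)
      else if hmm : mm = 0 then 0 else M (mm.pred hmm) (j.pred hj)
    else if hj : j = 0 then
      if hmm : mm = 0 then 0 else (if i = mm then α else 0) - M (mm.pred hmm) (i.pred hi)
    else 0

/-- The trivial singular extension `k^{n-2} ⋊_{(L₁,R₁,L₂,R₂)} χ` of the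
`2`-dimensional algebra `χ` given by the coefficients `c11, c12, c21, d12, d21, d22`
(with `χ(e₁,e₁) = c11·e₁ + e₂`, `χ(e₁,e₂) = c12·e₁ + d12·e₂`,
`χ(e₂,e₁) = c21·e₁ + d21·e₂`, `χ(e₂,e₂) = d22·e₂`). -/
def sdExt {m : ℕ} (c11 c12 c21 d12 d21 d22 : k)
    (L1 R1 L2 R2 : Matrix (Fin m) (Fin m) k) : AlgStr k (m + 2) :=
  ofConst fun i j mm =>
    if hi0 : (i : ℕ) = 0 then
      if hj0 : (j : ℕ) = 0 then
        if (mm : ℕ) = 0 then c11 else if (mm : ℕ) = 1 then 1 else 0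
      else if hj1 : (j : ℕ) = 1 then
        if (mm : ℕ) = 0 then c12 else if (mm : ℕ) = 1 then d12 else 0
      else if hmm : (mm : ℕ) < 2 then 0
      else L1 ⟨(mm : ℕ) - 2, by have := mm.isLt; omega⟩
             ⟨(j : ℕ) - 2, by have := j.isLt; omega⟩
    else if hi1 : (i : ℕ) = 1 then
      if hj0 : (j : ℕ) = 0 then
        if (mm : ℕ) = 0 then c21 else if (mm : ℕ) = 1 then d21 else 0
      else if hj1 : (j : ℕ) = 1 then
        if (mm : ℕ) = 1 then d22 else 0
      else if hmm : (mm : ℕ) < 2 then 0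
      else L2 ⟨(mm : ℕ) - 2, by have := mm.isLt; omega⟩
             ⟨(j : ℕ) - 2, by have := j.isLt; omega⟩
    else
      if hj0 : (j : ℕ) = 0 then
        if hmm : (mm : ℕ) < 2 then 0
        else R1 ⟨(mm : ℕ) - 2, by have := mm.isLt; omega⟩
               ⟨(i : ℕ) - 2, by have := i.isLt; omega⟩
      else if hj1 : (j : ℕ) = 1 then
        if hmm : (mm : ℕ) < 2 then 0
        else R2 ⟨(mm : ℕ) - 2, by have := mm.isLt; omega⟩
               ⟨(i : ℕ) - 2, by have := i.isLt; omega⟩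
      else 0

/-! Concrete algebra structures, given by multiplication tables on the standard
basis `e₁, …, eₙ` (0-indexed as `0, …, n-1`); all unspecified products are zero. -/

/-- `A₃ ⊕ k^{n-2}`: `e₁e₁ = e₂`. -/
def A3str (n : ℕ) : AlgStr k n :=
  ofConst fun i j m => if (i : ℕ) = 0 ∧ (j : ℕ) = 0 ∧ (m : ℕ) = 1 then 1 else 0

/-- `n₃ ⊕ k^{n-3}`: `e₁e₂ = e₃`, `e₂e₁ = -e₃`. -/
def n3str (n : ℕ) : AlgStr k n :=
  ofConst fun i j m =>
    if (i : ℕ) = 0 ∧ (j : ℕ) = 1 ∧ (m : ℕ) = 2 then 1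
    else if (i : ℕ) = 1 ∧ (j : ℕ) = 0 ∧ (m : ℕ) = 2 then -1
    else 0

/-- `p⁻`: `e₁eᵢ = eᵢ`, `eᵢe₁ = -eᵢ` for `i ≥ 2`. -/
def pminusStr (n : ℕ) : AlgStr k n :=
  ofConst fun i j m =>
    if (i : ℕ) = 0 ∧ 1 ≤ (j : ℕ) ∧ m = j then 1
    else if 1 ≤ (i : ℕ) ∧ (j : ℕ) = 0 ∧ m = i then -1
    else 0

/-- `ν^α`: `e₁e₁ = e₁`, `e₁eᵢ = α eᵢ`, `eᵢe₁ = (1-α) eᵢ` for `i ≥ 2`. -/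
def nuStr (n : ℕ) (α : k) : AlgStr k n :=
  ofConst fun i j m =>
    if (i : ℕ) = 0 then
      if (j : ℕ) = 0 then (if (m : ℕ) = 0 then 1 else 0)
      else (if m = j then α else 0)
    else if (j : ℕ) = 0 then (if m = i then 1 - α else 0)
    else 0

/-- `k^{n-2} ⋊ E₄`: `e₁e₁ = e₁`, `e₁e₂ = e₁ + e₂`, `e₂e₂ = e₂`,
`e₁eᵢ = eᵢ`, `eᵢe₂ = eᵢ` for `i ≥ 3`.  (For `n = 2` this is `E₄`.) -/
def kE4str (n : ℕ) : AlgStr k n :=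
  ofConst fun i j m =>
    if (i : ℕ) = 0 ∧ (j : ℕ) = 0 then (if (m : ℕ) = 0 then 1 else 0)
    else if (i : ℕ) = 0 ∧ (j : ℕ) = 1 then (if (m : ℕ) = 0 ∨ (m : ℕ) = 1 then 1 else 0)
    else if (i : ℕ) = 1 ∧ (j : ℕ) = 1 then (if (m : ℕ) = 1 then 1 else 0)
    else if (i : ℕ) = 0 ∧ 2 ≤ (j : ℕ) then (if m = j then 1 else 0)
    else if 2 ≤ (i : ℕ) ∧ (j : ℕ) = 1 then (if m = i then 1 else 0)
    else 0

/-- `T₀^{2,(α,β)}`: `e₁e₂ = αe₂ + e₃`, `e₂e₁ = -αe₂ - e₃`,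
`e₁eᵢ = βeᵢ`, `eᵢe₁ = -βeᵢ` for `i ≥ 3`. -/
def T02str (n : ℕ) (α β : k) : AlgStr k n :=
  ofConst fun i j m =>
    if (i : ℕ) = 0 ∧ (j : ℕ) = 1 then
      (if (m : ℕ) = 1 then α else if (m : ℕ) = 2 then 1 else 0)
    else if (i : ℕ) = 1 ∧ (j : ℕ) = 0 then
      (if (m : ℕ) = 1 then -α else if (m : ℕ) = 2 then -1 else 0)
    else if (i : ℕ) = 0 ∧ 2 ≤ (j : ℕ) then (if m = j then β else 0)
    else if 2 ≤ (i : ℕ) ∧ (j : ℕ) = 0 then (if m = i then -β else 0)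
    else 0

/-- `T₁^{2,(α,β)}`: `e₁e₁ = e₁`, `e₁e₂ = αe₂ + e₃`, `e₂e₁ = (1-α)e₂ - e₃`,
`e₁eᵢ = βeᵢ`, `eᵢe₁ = (1-β)eᵢ` for `i ≥ 3`. -/
def T12str (n : ℕ) (α β : k) : AlgStr k n :=
  ofConst fun i j m =>
    if (i : ℕ) = 0 ∧ (j : ℕ) = 0 then (if (m : ℕ) = 0 then 1 else 0)
    else if (i : ℕ) = 0 ∧ (j : ℕ) = 1 then
      (if (m : ℕ) = 1 then α else if (m : ℕ) = 2 then 1 else 0)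
    else if (i : ℕ) = 1 ∧ (j : ℕ) = 0 then
      (if (m : ℕ) = 1 then 1 - α else if (m : ℕ) = 2 then -1 else 0)
    else if (i : ℕ) = 0 ∧ 2 ≤ (j : ℕ) then (if m = j then β else 0)
    else if 2 ≤ (i : ℕ) ∧ (j : ℕ) = 0 then (if m = i then 1 - β else 0)
    else 0

/-- `T₀³`: `e₁e₂ = e₃`, `e₂e₁ = -e₃`, `e₁e₃ = e₄`, `e₃e₁ = -e₄`. -/
def T03str (n : ℕ) : AlgStr k n :=
  ofConst fun i j m =>
    if (i : ℕ) = 0 ∧ (j : ℕ) = 1 ∧ (m : ℕ) = 2 then 1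
    else if (i : ℕ) = 1 ∧ (j : ℕ) = 0 ∧ (m : ℕ) = 2 then -1
    else if (i : ℕ) = 0 ∧ (j : ℕ) = 2 ∧ (m : ℕ) = 3 then 1
    else if (i : ℕ) = 2 ∧ (j : ℕ) = 0 ∧ (m : ℕ) = 3 then -1
    else 0

/-- `T₀^{2,2}`: `e₁e₂ = e₃`, `e₂e₁ = -e₃`, `e₁e₄ = e₅`, `e₄e₁ = -e₅`. -/
def T022str (n : ℕ) : AlgStr k n :=
  ofConst fun i j m =>
    if (i : ℕ) = 0 ∧ (j : ℕ) = 1 ∧ (m : ℕ) = 2 then 1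
    else if (i : ℕ) = 1 ∧ (j : ℕ) = 0 ∧ (m : ℕ) = 2 then -1
    else if (i : ℕ) = 0 ∧ (j : ℕ) = 3 ∧ (m : ℕ) = 4 then 1
    else if (i : ℕ) = 3 ∧ (j : ℕ) = 0 ∧ (m : ℕ) = 4 then -1
    else 0

/-- `η_l ⊕ k^{n-2l-1}`: `e_{2i-1}e_{2i} = e_{2l+1}`, `e_{2i}e_{2i-1} = -e_{2l+1}`
for `1 ≤ i ≤ l`. -/
def etaStr (n l : ℕ) : AlgStr k n :=
  ofConst fun i j m =>
    if (i : ℕ) % 2 = 0 ∧ (j : ℕ) = (i : ℕ) + 1 ∧ (i : ℕ) < 2 * l ∧ (m : ℕ) = 2 * l then 1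
    else if (j : ℕ) % 2 = 0 ∧ (i : ℕ) = (j : ℕ) + 1 ∧ (j : ℕ) < 2 * l ∧ (m : ℕ) = 2 * l then -1
    else 0

/-- `F^{α,β} ⊕ k^{n-3}`: `e₁e₁ = e₃`, `e₁e₂ = αe₃`, `e₂e₁ = βe₃`. -/
def FabStr (n : ℕ) (α β : k) : AlgStr k n :=
  ofConst fun i j m =>
    if (i : ℕ) = 0 ∧ (j : ℕ) = 0 ∧ (m : ℕ) = 2 then 1
    else if (i : ℕ) = 0 ∧ (j : ℕ) = 1 ∧ (m : ℕ) = 2 then α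
    else if (i : ℕ) = 1 ∧ (j : ℕ) = 0 ∧ (m : ℕ) = 2 then β
    else 0

/-- `k^{n-2} ⋊ A₃`: `e₁e₁ = e₂`, `e₁eᵢ = eᵢ`, `eᵢe₁ = -eᵢ` for `i ≥ 3`. -/
def kA3str (n : ℕ) : AlgStr k n :=
  ofConst fun i j m =>
    if (i : ℕ) = 0 ∧ (j : ℕ) = 0 ∧ (m : ℕ) = 1 then 1
    else if (i : ℕ) = 0 ∧ 2 ≤ (j : ℕ) then (if m = j then 1 else 0)
    else if 2 ≤ (i : ℕ) ∧ (j : ℕ) = 0 then (if m = i then -1 else 0)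
    else 0

/-- `k² ⋊_{α,β} A₃ ⊕ k^{n-4}`: `e₁e₁ = e₂`, `e₁e₃ = αe₄`, `e₃e₁ = βe₄`. -/
def k2A3str (n : ℕ) (α β : k) : AlgStr k n :=
  ofConst fun i j m =>
    if (i : ℕ) = 0 ∧ (j : ℕ) = 0 ∧ (m : ℕ) = 1 then 1
    else if (i : ℕ) = 0 ∧ (j : ℕ) = 2 ∧ (m : ℕ) = 3 then α
    else if (i : ℕ) = 2 ∧ (j : ℕ) = 0 ∧ (m : ℕ) = 3 then β
    else 0

/-- `k^{n-2} ⋊_α A₁^α`: `e₁e₁ = e₁ + e₂`, `e₁eᵢ = αeᵢ`, `eᵢe₁ = (1-α)eᵢ` for `i ≥ 2`. -/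
def kA1str (n : ℕ) (α : k) : AlgStr k n :=
  ofConst fun i j m =>
    if (i : ℕ) = 0 ∧ (j : ℕ) = 0 then (if (m : ℕ) = 0 ∨ (m : ℕ) = 1 then 1 else 0)
    else if (i : ℕ) = 0 then (if m = j then α else 0)
    else if (j : ℕ) = 0 then (if m = i then 1 - α else 0)
    else 0

/-- `k^{n-2} ⋊₁ A₂`: `e₁e₁ = e₂`, `e₁eᵢ = eᵢ`, `eᵢe₁ = -eᵢ` for `i ≥ 2`. -/
def kA2str (n : ℕ) : AlgStr k n :=
  ofConst fun i j m =>
    if (i : ℕ) = 0 ∧ (j : ℕ) = 0 then (if (m : ℕ) = 1 then 1 else 0)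
    else if (i : ℕ) = 0 then (if m = j then 1 else 0)
    else if (j : ℕ) = 0 then (if m = i then -1 else 0)
    else 0

/-- `k^{n-2} ⋊₀ᵗ B₂^α`: `e₁eᵢ = αeᵢ`, `eᵢe₁ = (1-α)eᵢ` for `i ≥ 2`. -/
def ktB2str (n : ℕ) (α : k) : AlgStr k n :=
  ofConst fun i j m =>
    if (i : ℕ) = 0 ∧ 1 ≤ (j : ℕ) then (if m = j then α else 0)
    else if 1 ≤ (i : ℕ) ∧ (j : ℕ) = 0 then (if m = i then 1 - α else 0)
    else 0

/-- `k^{n-2} ⋊₀ᵗ D₂^{α,β}`: `e₁e₁ = e₁`, `e₁eᵢ = αeᵢ`, `eᵢe₁ = βeᵢ` for `i ≥ 2`. -/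
def ktD2str (n : ℕ) (α β : k) : AlgStr k n :=
  ofConst fun i j m =>
    if (i : ℕ) = 0 ∧ (j : ℕ) = 0 then (if (m : ℕ) = 0 then 1 else 0)
    else if (i : ℕ) = 0 then (if m = j then α else 0)
    else if (j : ℕ) = 0 then (if m = i then β else 0)
    else 0

/-! ### Transport and orbits -/

@[simp]
theorem transport_apply {n : ℕ} (g : (Fin n → k) ≃ₗ[k] (Fin n → k)) (μ : AlgStr k n)
    (x y : Fin n → k) : transport g μ x y = g (μ (g.symm x) (g.symm y)) := rfl

theorem transport_mem_orbit {n : ℕ} (g : (Fin n → k) ≃ₗ[k] (Fin n → k)) (μ : AlgStr k n) :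
    transport g μ ∈ orbit μ := ⟨g, rfl⟩

theorem mem_orbit_iff {n : ℕ} {μ χ : AlgStr k n} :
    χ ∈ orbit μ ↔ ∃ g : (Fin n → k) ≃ₗ[k] (Fin n → k), ∀ x y, g (μ x y) = χ (g x) (g y) := by
  constructor
  · rintro ⟨g, rfl⟩
    exact ⟨g, fun x y => by simp⟩
  · rintro ⟨g, hg⟩
    refine ⟨g, ?_⟩
    exact LinearMap.ext₂ fun x y => by simp [hg]

theorem orbit_refl {n : ℕ} (μ : AlgStr k n) : μ ∈ orbit μ :=
  mem_orbit_iff.2 ⟨LinearEquiv.refl k _, fun _ _ => rfl⟩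

theorem orbit_symm {n : ℕ} {μ χ : AlgStr k n} (h : χ ∈ orbit μ) : μ ∈ orbit χ := by
  obtain ⟨g, hg⟩ := mem_orbit_iff.1 h
  exact mem_orbit_iff.2 ⟨g.symm, fun x y => by simp [g.symm_apply_eq, hg]⟩

/-! ### Chains of degenerations -/

theorem hasChain_zero {n : ℕ} (μ : AlgStr k n) : hasChain μ 0 :=
  ⟨fun _ => μ, rfl, fun i hi => absurd hi (Nat.not_lt_zero i)⟩

theorem hasChain_succ {n : ℕ} {μ : AlgStr k n} {m : ℕ} :
    hasChain μ (m + 1) ↔ ∃ ν, properlyDegenerates μ ν ∧ hasChain ν m := by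
  constructor
  · rintro ⟨c, rfl, hc⟩
    exact ⟨c m, hc m (Nat.lt_succ_self m), c, rfl, fun i hi => hc i (hi.trans (Nat.lt_succ_self m))⟩
  · rintro ⟨ν, hν, c, rfl, hc⟩
    refine ⟨fun i => if i = m + 1 then μ else c i, by simp, fun i hi => ?_⟩
    rcases Nat.lt_succ_iff_lt_or_eq.1 hi with h | rfl
    · have h1 : i ≠ m := h.ne
      have h2 : i ≠ m + 1 := by omega
      simpa [h1, h2] using hc i h
    · simpa using hν

theorem hasChain_mono {n : ℕ} {m m' : ℕ} (hmm : m' ≤ m) :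
    ∀ {μ : AlgStr k n}, hasChain μ m → hasChain μ m' := by
  induction m' generalizing m with
  | zero => exact fun _ => hasChain_zero _
  | succ m' ih =>
    intro μ h
    obtain ⟨m, rfl⟩ : ∃ j, m = j + 1 := ⟨m - 1, by omega⟩
    obtain ⟨ν, hν, h⟩ := hasChain_succ.1 h
    exact hasChain_succ.2 ⟨ν, hν, ih (by omega) h⟩

/-! ### Polynomial functions on the space of structures -/

/-- A function on `AlgStr k n` that is polynomial in the structure constants. -/
def IsPolyFun {n : ℕ} (F : AlgStr k n → k) : Prop :=
  ∃ p : MvPolynomial (Fin n × Fin n × Fin n) k, ∀ μ, F μ = MvPolynomial.eval (structConst μ) p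

theorem degenerates.eq_zero {n : ℕ} {μ χ : AlgStr k n} (h : degenerates μ χ) {F : AlgStr k n → k}
    (hF : IsPolyFun F) (h0 : ∀ ν ∈ orbit μ, F ν = 0) : F χ = 0 := by
  obtain ⟨p, hp⟩ := hF
  exact h {ν | F ν = 0} ⟨{p}, fun ν => by simp [hp]⟩ h0

namespace IsPolyFun

variable {n : ℕ} {F G : AlgStr k n → k}

theorem const (c : k) : IsPolyFun fun _ : AlgStr k n => c := ⟨MvPolynomial.C c, by simp⟩

theorem mul (hF : IsPolyFun F) (hG : IsPolyFun G) : IsPolyFun fun μ => F μ * G μ := by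
  obtain ⟨p, hp⟩ := hF
  obtain ⟨q, hq⟩ := hG
  exact ⟨p * q, by simp [hp, hq]⟩

theorem sub (hF : IsPolyFun F) (hG : IsPolyFun G) : IsPolyFun fun μ => F μ - G μ := by
  obtain ⟨p, hp⟩ := hF
  obtain ⟨q, hq⟩ := hG
  exact ⟨p - q, by simp [hp, hq]⟩

theorem sum {ι : Type*} (s : Finset ι) {F : ι → AlgStr k n → k} (hF : ∀ i, IsPolyFun (F i)) :
    IsPolyFun fun μ => ∑ i ∈ s, F i μ := by
  choose p hp using hF
  exact ⟨∑ i ∈ s, p i, by simp [hp]⟩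

theorem prod {ι : Type*} (s : Finset ι) {F : ι → AlgStr k n → k} (hF : ∀ i, IsPolyFun (F i)) :
    IsPolyFun fun μ => ∏ i ∈ s, F i μ := by
  choose p hp using hF
  exact ⟨∏ i ∈ s, p i, by simp [hp, map_prod]⟩

theorem det {ι : Type*} [Fintype ι] [DecidableEq ι] {F : ι → ι → AlgStr k n → k}
    (hF : ∀ i j, IsPolyFun (F i j)) :
    IsPolyFun fun μ => Matrix.det (Matrix.of fun i j => F i j μ) := by
  simp only [Matrix.det_apply']
  exact sum _ fun σ => mul (const _) (prod _ fun i => hF _ _)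

end IsPolyFun

/-- The structure constants, as a linear map. -/
def structConstₗ (k : Type*) [Field k] (n : ℕ) :
    AlgStr k n →ₗ[k] (Fin n × Fin n × Fin n → k) where
  toFun := structConst
  map_add' _ _ := rfl
  map_smul' _ _ := rfl

theorem structConst_injective {n : ℕ} : Function.Injective (structConst (k := k) (n := n)) := by
  intro μ χ h
  ext i j m
  simpa [structConst] using congrFun h (i, j, m)

theorem IsPolyFun.linear {n : ℕ} (Φ : AlgStr k n →ₗ[k] k) : IsPolyFun Φ := by
  obtain ⟨G, hG⟩ := LinearMap.exists_leftInverse_of_injective (V := AlgStr k n) (structConstₗ k n)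
    (LinearMap.ker_eq_bot_of_injective structConst_injective)
  refine ⟨∑ t, MvPolynomial.X t * MvPolynomial.C (Φ (G (Pi.single t 1))), fun μ => ?_⟩
  have h1 : G (structConst μ) = μ := LinearMap.congr_fun hG μ
  conv_lhs => rw [← h1, pi_eq_sum_univ' (structConst μ)]
  simp [map_sum]

theorem IsPolyFun.apply {n : ℕ} (φ : (Fin n → k) →ₗ[k] k) (x y : Fin n → k) :
    IsPolyFun fun μ : AlgStr k n => φ (μ x y) :=
  .linear (φ ∘ₗ LinearMap.applyₗ y ∘ₗ LinearMap.applyₗ x)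

theorem degenerates.mem_submodule {n : ℕ} {μ χ : AlgStr k n} (h : degenerates μ χ)
    {W : Submodule k (AlgStr k n)} (hW : ∀ ν ∈ orbit μ, ν ∈ W) : χ ∈ W := by
  by_contra hχ
  obtain ⟨Φ, hΦ, hle⟩ := Submodule.exists_le_ker_of_notMem (V := AlgStr k n) hχ
  exact hΦ (h.eq_zero (.linear Φ) fun ν hν => hle (hW ν hν))

theorem degenerates_of_family [Infinite k] {n : ℕ} {μ χ : AlgStr k n}
    (c : Fin n × Fin n × Fin n → Polynomial k)
    (hc : ∀ t : k, t ≠ 0 → ∃ ν ∈ orbit μ, ∀ i, structConst ν i = (c i).eval t)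
    (h0 : ∀ i, structConst χ i = (c i).eval 0) : degenerates μ χ := by
  rintro S ⟨P, hP⟩ hS
  refine (hP χ).2 fun p hp => ?_
  have key : ∀ t, MvPolynomial.eval (fun i => (c i).eval t) p
      = (MvPolynomial.aeval c p : Polynomial k).eval t := by
    intro t
    rw [MvPolynomial.aeval_def, ← Polynomial.coe_evalRingHom, MvPolynomial.hom_eval₂]
    rw [MvPolynomial.eval, MvPolynomial.coe_eval₂Hom]
    congr 1
    ext a
    simp
  have hz : (MvPolynomial.aeval c p : Polynomial k) = 0 := by
    apply Polynomial.eq_zero_of_infinite_isRoot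
    refine Set.Infinite.mono ?_ (Set.finite_singleton (0 : k)).infinite_compl
    intro t ht
    obtain ⟨ν, hν, h⟩ := hc t ht
    have := (hP ν).1 (hS hν) p hp
    rw [funext h] at this
    exact (key t).symm.trans this
  rw [funext h0, key, hz, Polynomial.eval_zero]

theorem exists_linearEquiv_apply_eq {V ι : Type*} [AddCommGroup V] [Module k V]
    [FiniteDimensional k V] {u v : ι → V} (hu : LinearIndependent k u)
    (hv : LinearIndependent k v) : ∃ g : V ≃ₗ[k] V, ∀ i, g (u i) = v i := by
  obtain ⟨g, hg⟩ := Submodule.exists_linearEquiv_restrict_eq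
    ((Module.Basis.span hu).equiv (Module.Basis.span hv) (Equiv.refl ι))
  refine ⟨g, fun i => ?_⟩
  have h := hg (Module.Basis.span hu i)
  rw [Module.Basis.equiv_apply] at h
  simpa [Module.Basis.span_apply] using h.symm

theorem exists_linearEquiv_comp_eq {V ι : Type*} [AddCommGroup V] [Module k V]
    [FiniteDimensional k V] {u v : ι → Module.Dual k V} (hu : LinearIndependent k u)
    (hv : LinearIndependent k v) : ∃ g : V ≃ₗ[k] V, ∀ i x, v i (g x) = u i x := by
  obtain ⟨G, hG⟩ := exists_linearEquiv_apply_eq hv hu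
  refine ⟨(Module.evalEquiv k V).trans (G.dualMap.trans (Module.evalEquiv k V).symm),
    fun i x => ?_⟩
  simp [hG]

/-! ### Structures of the form `x * y = l x • y + h y • x` -/

/-- The structure `x * y = l x • y + h y • x` attached to a pair of functionals `(l, h)`. -/
def formStr (k : Type*) [Field k] (n : ℕ) :
    (Module.Dual k (Fin n → k) × Module.Dual k (Fin n → k)) →ₗ[k] AlgStr k n where
  toFun p := (LinearMap.lsmul k (Fin n → k)).comp p.1 +
    ((LinearMap.lsmul k (Fin n → k)).comp p.2).flip
  map_add' p q := LinearMap.ext₂ fun x y => by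
    simp
    abel
  map_smul' c p := LinearMap.ext₂ fun x y => by simp [mul_smul]

@[simp]
theorem formStr_apply {n : ℕ} (p : Module.Dual k (Fin n → k) × Module.Dual k (Fin n → k))
    (x y : Fin n → k) : formStr k n p x y = p.1 x • y + p.2 y • x := rfl

/-- The pair `(α • φ, β • φ)`, depending linearly on `φ`. -/
def proportional {n : ℕ} (α β : k) : Module.Dual k (Fin n → k) →ₗ[k]
    (Module.Dual k (Fin n → k) × Module.Dual k (Fin n → k)) :=
  (α • LinearMap.id).prod (β • LinearMap.id)

theorem exists_proportional {n : ℕ} {l h : Module.Dual k (Fin n → k)}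
    (H : ¬ LinearIndependent k ![l, h]) : ∃ α β φ, (l, h) = proportional α β φ := by
  rw [LinearIndependent.pair_iff] at H
  push Not at H
  obtain ⟨s, t, hst, hne⟩ := H
  by_cases hs : s = 0
  · have ht : t ≠ 0 := hne hs
    refine ⟨1, 0, l, ?_⟩
    have : h = 0 := by simpa [hs, ht] using hst
    simp [proportional, this]
  · refine ⟨-(s⁻¹ * t), 1, h, ?_⟩
    have : l = -(s⁻¹ * t) • h := by
      have h1 : s⁻¹ • (s • l + t • h) = 0 := by rw [hst, smul_zero]
      rw [smul_add, inv_smul_smul₀ hs] at h1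
      linear_combination (norm := module) h1
    simp [proportional, ← this]

theorem transport_formStr {n : ℕ} (g : (Fin n → k) ≃ₗ[k] (Fin n → k))
    (p : Module.Dual k (Fin n → k) × Module.Dual k (Fin n → k)) :
    transport g (formStr k n p)
      = formStr k n (p.1 ∘ₗ g.symm.toLinearMap, p.2 ∘ₗ g.symm.toLinearMap) :=
  LinearMap.ext₂ fun x y => by simp

theorem degenerates_formStr {n : ℕ}
    {p : Module.Dual k (Fin n → k) × Module.Dual k (Fin n → k)} {ν : AlgStr k n}
    (h : degenerates (formStr k n p) ν) : ∃ q, ν = formStr k n q := by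
  have : ν ∈ LinearMap.range (formStr k n) := h.mem_submodule <| by
    rintro _ ⟨g, rfl⟩
    exact ⟨_, (transport_formStr g p).symm⟩
  obtain ⟨q, rfl⟩ := this
  exact ⟨q, rfl⟩

theorem degenerates_formStr_proportional {n : ℕ} {α β : k} {φ : Module.Dual k (Fin n → k)}
    {ν : AlgStr k n} (h : degenerates (formStr k n (proportional α β φ)) ν) :
    ∃ ψ, ν = formStr k n (proportional α β ψ) := by
  have : ν ∈ LinearMap.range (formStr k n ∘ₗ proportional α β) := h.mem_submodule <| by
    rintro _ ⟨g, rfl⟩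
    exact ⟨φ ∘ₗ g.symm.toLinearMap, (transport_formStr g (proportional α β φ)).symm⟩
  obtain ⟨q, rfl⟩ := this
  exact ⟨q, rfl⟩

theorem degenerates_zero_left {n : ℕ} {ν : AlgStr k n} (h : degenerates (0 : AlgStr k n) ν) :
    ν = 0 := by
  rw [← Submodule.mem_bot k]
  refine h.mem_submodule ?_
  rintro _ ⟨g, rfl⟩
  exact (Submodule.mem_bot k).2 (LinearMap.ext₂ fun x y => by simp)

theorem not_properlyDegenerates_zero {n : ℕ} {ν : AlgStr k n} :
    ¬ properlyDegenerates (0 : AlgStr k n) ν := by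
  rintro ⟨h, h'⟩
  rw [degenerates_zero_left h] at h'
  exact h' (orbit_refl _)

theorem formStr_mem_orbit {n : ℕ}
    {p q : Module.Dual k (Fin n → k) × Module.Dual k (Fin n → k)}
    (g : (Fin n → k) ≃ₗ[k] (Fin n → k)) (h1 : ∀ x, q.1 (g x) = p.1 x)
    (h2 : ∀ x, q.2 (g x) = p.2 x) : formStr k n q ∈ orbit (formStr k n p) :=
  mem_orbit_iff.2 ⟨g, fun x y => by simp [h1, h2]⟩

theorem properlyDegenerates_proportional {n : ℕ} {α β : k} {φ : Module.Dual k (Fin n → k)}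
    {ν : AlgStr k n} (h : properlyDegenerates (formStr k n (proportional α β φ)) ν) : ν = 0 := by
  obtain ⟨ψ, rfl⟩ := degenerates_formStr_proportional h.1
  by_cases hφ : φ = 0
  · rw [hφ, map_zero, map_zero] at h
    exact absurd h not_properlyDegenerates_zero
  by_cases hψ : ψ = 0
  · rw [hψ, map_zero, map_zero]
  refine absurd ?_ h.2
  obtain ⟨g, hg⟩ := exists_linearEquiv_comp_eq
    (u := fun _ : Unit => φ) (v := fun _ : Unit => ψ)
    (LinearIndependent.of_subsingleton (R := k) () hφ)
    (LinearIndependent.of_subsingleton (R := k) () hψ)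
  exact formStr_mem_orbit g (fun x => by simp [proportional, hg ()])
    fun x => by simp [proportional, hg ()]

theorem properlyDegenerates_formStr {n : ℕ}
    {p : Module.Dual k (Fin n → k) × Module.Dual k (Fin n → k)} {ν : AlgStr k n}
    (h : properlyDegenerates (formStr k n p) ν) :
    ∃ α β φ, ν = formStr k n (proportional α β φ) := by
  by_cases hp : LinearIndependent k ![p.1, p.2]
  · obtain ⟨q, rfl⟩ := degenerates_formStr h.1
    by_cases hq : LinearIndependent k ![q.1, q.2]
    · obtain ⟨g, hg⟩ := exists_linearEquiv_comp_eq hp hq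
      exact absurd (formStr_mem_orbit g (hg 0) (hg 1)) h.2
    · obtain ⟨α, β, φ, hφ⟩ := exists_proportional hq
      exact ⟨α, β, φ, by rw [← hφ]⟩
  · obtain ⟨α, β, φ, hφ⟩ := exists_proportional hp
    have h' := h.1
    rw [← Prod.mk.eta (p := p), hφ] at h'
    obtain ⟨ψ, hψ⟩ := degenerates_formStr_proportional h'
    exact ⟨α, β, ψ, hψ⟩

theorem not_hasChain_three_formStr {n : ℕ}
    (p : Module.Dual k (Fin n → k) × Module.Dual k (Fin n → k)) :
    ¬ hasChain (formStr k n p) 3 := by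
  intro h
  obtain ⟨ν₂, h₂, h⟩ := hasChain_succ.1 h
  obtain ⟨ν₁, h₁, h⟩ := hasChain_succ.1 h
  obtain ⟨ν₀, h₀, -⟩ := hasChain_succ.1 h
  obtain ⟨α, β, φ, rfl⟩ := properlyDegenerates_formStr h₂
  rw [properlyDegenerates_proportional h₁] at h₀
  exact not_properlyDegenerates_zero h₀

/-! ### Structures in which every square `x * x` is a multiple of `x` -/

theorem exists_ne_zero_ne_one (k : Type*) [Field k] [Infinite k] : ∃ t : k, t ≠ 0 ∧ t ≠ 1 := by
  obtain ⟨t, ht⟩ := ({0, 1} : Set k).toFinite.infinite_compl.nonempty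
  exact ⟨t, by simpa [not_or] using ht⟩

/-- Polarization of the identity `x * x = f x • x`. -/
theorem mul_add_mul_of_sq [Infinite k] {n : ℕ} {μ : AlgStr k n}
    (hsq : ∀ x, ∃ c : k, μ x x = c • x) {x y : Fin n → k} (hxy : LinearIndependent k ![x, y])
    {a b : k} (ha : μ x x = a • x) (hb : μ y y = b • y) : μ x y + μ y x = b • x + a • y := by
  obtain ⟨t, ht0, ht1⟩ := exists_ne_zero_ne_one k
  obtain ⟨γ, hγ⟩ := hsq (x + y)
  obtain ⟨δ, hδ⟩ := hsq (x + t • y)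
  simp only [map_add, LinearMap.add_apply, map_smul, LinearMap.smul_apply, ha, hb] at hγ hδ
  have e1 : μ x y + μ y x = (γ - a) • x + (γ - b) • y := by linear_combination (norm := module) hγ
  have e2 : (a + t * (γ - a) - δ) • x + (t * (γ - b) + t * t * b - t * δ) • y = 0 := by
    linear_combination (norm := module) hδ - t • e1
  obtain ⟨h1, h2⟩ := LinearIndependent.pair_iff.1 hxy _ _ e2
  have h3 : (γ - b) + t * b = a + t * (γ - a) := by
    apply mul_left_cancel₀ ht0
    linear_combination h2 - t * h1
  have h4 : γ = a + b := by
    have : (t - 1) * (γ - (a + b)) = 0 := by linear_combination -h3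
    rcases mul_eq_zero.1 this with h | h
    · exact absurd (sub_eq_zero.1 h) ht1
    · exact sub_eq_zero.1 h
  rw [e1, h4]
  congr 2 <;> ring

/-- Left multiplication by `a` is scalar modulo `a`. -/
def IsScalarAt {n : ℕ} (μ : AlgStr k n) (a : Fin n → k) : Prop :=
  ∃ c : k, ∀ y, ∃ s : k, μ a y = c • y + s • a

theorem exists_formStr_of_span_eq_top [Infinite k] {n : ℕ} {μ : AlgStr k n}
    (hsq : ∀ x, ∃ c : k, μ x x = c • x) (hspan : Submodule.span k {a | IsScalarAt μ a} = ⊤) :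
    ∃ p, μ = formStr k n p := by
  let b := Module.Basis.ofSpan hspan.ge
  have hb : ∀ i, IsScalarAt μ (b i) := fun i =>
    Module.Basis.ofSpan_subset hspan.ge (Set.mem_range_self i)
  choose c s hs using hb
  choose f hf using fun i => hsq (b i)
  refine ⟨(b.constr k c, b.constr k fun i => f i - c i), b.ext fun i => b.ext fun j => ?_⟩
  rw [formStr_apply, b.constr_basis, b.constr_basis]
  by_cases hij : i = j
  · subst hij
    rw [hf, ← add_smul]
    congr 1
    ring
  have hli : LinearIndependent k ![b i, b j] := by
    have e : ![b i, b j] = b ∘ ![i, j] := by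
      ext u : 1
      fin_cases u <;> rfl
    rw [e]
    refine b.linearIndependent.comp _ fun u v => ?_
    fin_cases u <;> fin_cases v <;> simp [hij, Ne.symm hij]
  have h1 := mul_add_mul_of_sq hsq hli (hf i) (hf j)
  rw [hs i (b j), hs j (b i)] at h1
  have h2 : (s i (b j) + c j - f j) • b i + (c i + s j (b i) - f i) • b j = 0 := by
    linear_combination (norm := module) h1
  obtain ⟨h3, -⟩ := LinearIndependent.pair_iff.1 hli _ _ h2
  rw [hs i (b j)]
  congr 2
  linear_combination h3

theorem exists_linearIndependent_of_not_isScalarAt {n : ℕ} {μ : AlgStr k n}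
    (hsq : ∀ x, ∃ c : k, μ x x = c • x) {a : Fin n → k} (ha : ¬ IsScalarAt μ a) :
    ∃ v, LinearIndependent k ![a, v, μ a v] := by
  by_contra! H
  apply ha
  have ha0 : a ≠ 0 := by
    rintro rfl
    exact ha ⟨0, fun y => ⟨0, by simp⟩⟩
  let W := Submodule.span k {a}
  have hW : W ≤ W.comap (μ a) := by
    rw [Submodule.span_le, Set.singleton_subset_iff]
    obtain ⟨c, hc⟩ := hsq a
    exact Submodule.mem_span_singleton.2 ⟨c, hc.symm⟩
  obtain ⟨c, hc⟩ := LinearMap.exists_eq_smul_id_of_forall_notLinearIndependent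
    (f := W.mapQ W (μ a) hW) (by
      intro q hq
      obtain ⟨v, rfl⟩ := W.mkQ_surjective q
      refine H v ?_
      have hv : W.mapQ W (μ a) hW (W.mkQ v) = W.mkQ (μ a v) := rfl
      rw [hv, LinearIndependent.pair_iff] at hq
      rw [Fintype.linearIndependent_iff]
      intro g hg
      simp only [Fin.sum_univ_three, Matrix.cons_val_zero, Matrix.cons_val_one,
        Matrix.cons_val_two, Matrix.tail_cons, Matrix.head_cons] at hg
      have ha' : W.mkQ a = 0 :=
        (Submodule.Quotient.mk_eq_zero W).2 (Submodule.mem_span_singleton_self a)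
      have h12 := hq (g 1) (g 2) (by
        have := congrArg W.mkQ hg
        simpa [ha', -Submodule.mkQ_apply] using this)
      have h0 : g 0 = 0 := by simpa [h12.1, h12.2, ha0] using hg
      intro i
      fin_cases i
      exacts [h0, h12.1, h12.2])
  refine ⟨c, fun y => ?_⟩
  have h := LinearMap.congr_fun hc (W.mkQ y)
  have h' : μ a y - c • y ∈ W := by
    rw [← Submodule.Quotient.mk_eq_zero W, Submodule.Quotient.mk_sub, Submodule.Quotient.mk_smul,
      sub_eq_zero]
    simpa using h
  obtain ⟨s, hs⟩ := Submodule.mem_span_singleton.1 h'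
  exact ⟨s, by rw [hs]; abel⟩

theorem exists_sq_eq_smul_of_genType {n : ℕ} {μ : AlgStr k n} (hG : genType μ 1)
    (x : Fin n → k) : ∃ c : k, μ x x = c • x := by
  have hle : Module.finrank k (subalgGen μ {x}) ≤ 1 := hG.2 ⟨x, rfl⟩
  have hx : x ∈ subalgGen μ {x} := by
    rw [subalgGen, Submodule.mem_sInf]
    exact fun W hW => hW.1 rfl
  have hxx : μ x x ∈ subalgGen μ {x} := by
    rw [subalgGen, Submodule.mem_sInf]
    exact fun W hW => hW.2 x (hW.1 rfl) x (hW.1 rfl)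
  by_cases h0 : x = 0
  · exact ⟨0, by simp [h0]⟩
  obtain ⟨⟨v, hv⟩, h⟩ := finrank_le_one_iff.1 hle
  obtain ⟨a, ha⟩ := h ⟨x, hx⟩
  obtain ⟨b, hb⟩ := h ⟨μ x x, hxx⟩
  simp only [SetLike.mk_smul_mk, Subtype.mk.injEq] at ha hb
  have ha0 : a ≠ 0 := by
    rintro rfl
    exact h0 (by simpa using ha.symm)
  exact ⟨b * a⁻¹, by rw [← hb, ← ha, smul_smul, inv_mul_cancel_right₀ ha0]⟩

/-! ### Sums of exterior products of functionals -/

section Wedge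

variable {V : Type*} [AddCommGroup V] [Module k V]

/-- The alternating form `∑ i, p i ∧ q i`. -/
def wedgeSum {l : ℕ} (p q : Fin l → Module.Dual k V) (x y : V) : k :=
  ∑ i, (p i x * q i y - q i x * p i y)

theorem wedgeSum_eq_zero {l : ℕ} {p q : Fin l → Module.Dual k V}
    (hpq : LinearIndependent k (Sum.elim p q)) {x : V} (hx : ∀ y, wedgeSum p q x y = 0)
    (i : Fin l) : p i x = 0 ∧ q i x = 0 := by
  have h := Fintype.linearIndependent_iff.1 hpq
    (Sum.elim (fun i => -q i x) (fun i => p i x)) (by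
      ext y
      have := hx y
      simp only [wedgeSum, Finset.sum_sub_distrib] at this
      simp only [Fintype.sum_sum_type, Sum.elim_inl, Sum.elim_inr, LinearMap.add_apply,
        LinearMap.sum_apply, LinearMap.smul_apply, smul_eq_mul, neg_mul, Finset.sum_neg_distrib,
        LinearMap.zero_apply]
      linear_combination this)
  exact ⟨by simpa using h (Sum.inr i), by simpa using h (Sum.inl i)⟩

theorem exists_eq_wedgeSum [FiniteDimensional k V] (d : ℕ) :
    ∀ ω : V →ₗ[k] V →ₗ[k] k, (∀ x, ω x x = 0) → Module.finrank k (LinearMap.range ω) ≤ d →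
      ∃ (l : ℕ) (p q : Fin l → Module.Dual k V), LinearIndependent k (Sum.elim p q) ∧
        ∀ x y, ω x y = wedgeSum p q x y := by
  induction d with
  | zero =>
    intro ω _ hd
    have h0 : ω = 0 := by
      rw [← LinearMap.range_eq_bot]
      exact Submodule.finrank_eq_zero.1 (Nat.le_zero.1 hd)
    refine ⟨0, Fin.elim0, Fin.elim0, linearIndependent_empty_type, fun x y => ?_⟩
    simp [h0, wedgeSum]
  | succ d ih =>
    intro ω hω hd
    have hanti : ∀ x y, ω x y = -ω y x := fun x y => by
      have := hω (x + y)
      simp only [map_add, LinearMap.add_apply, hω] at this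
      linear_combination this
    by_cases h0 : ∀ x y, ω x y = 0
    · refine ⟨0, Fin.elim0, Fin.elim0, linearIndependent_empty_type, fun x y => ?_⟩
      simp [h0, wedgeSum]
    push Not at h0
    obtain ⟨x₀, y₁, h1⟩ := h0
    obtain ⟨y₀, h1⟩ : ∃ y₀, ω x₀ y₀ = 1 := ⟨(ω x₀ y₁)⁻¹ • y₁, by simp [h1]⟩
    let p₀ : Module.Dual k V := ω.flip y₀
    let q₀ : Module.Dual k V := ω x₀
    let ω' : V →ₗ[k] V →ₗ[k] k :=
      ω - ((LinearMap.mul k k).compl₁₂ p₀ q₀ - (LinearMap.mul k k).compl₁₂ q₀ p₀)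
    have hω' : ∀ x y, ω' x y = ω x y - (ω x y₀ * ω x₀ y - ω x₀ x * ω y y₀) := fun x y => rfl
    have hx₀ : ∀ y, ω' x₀ y = 0 := fun y => by
      rw [hω', h1, hω]
      ring
    have hy₀ : ∀ y, ω' y₀ y = 0 := fun y => by
      rw [hω', h1, hω, hanti y y₀]
      ring
    have hker : LinearMap.ker ω < LinearMap.ker ω' := by
      refine lt_of_le_of_ne (fun w hw => ?_) fun h => ?_
      · have hw' : ω w = 0 := hw
        refine LinearMap.ext fun y => ?_
        rw [hω', hanti x₀ w, hw']
        simp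
      · have : x₀ ∈ LinearMap.ker ω := h ▸ LinearMap.ext hx₀
        rw [LinearMap.mem_ker.1 this] at h1
        exact zero_ne_one h1
    have hr := ω.finrank_range_add_finrank_ker
    have hr' := ω'.finrank_range_add_finrank_ker
    have hlt := Submodule.finrank_lt_finrank_of_lt hker
    obtain ⟨l, p, q, hpq, hsum⟩ := ih ω' (fun x => by
      rw [hω', hω]
      ring) (by omega)
    have hx := wedgeSum_eq_zero hpq fun y => (hsum x₀ y).symm.trans (hx₀ y)
    have hy := wedgeSum_eq_zero hpq fun y => (hsum y₀ y).symm.trans (hy₀ y)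
    refine ⟨l + 1, Fin.cons p₀ p, Fin.cons q₀ q, ?_, fun x y => ?_⟩
    · rw [Fintype.linearIndependent_iff]
      intro c hc
      have hc' : ∀ v, c (Sum.inl 0) * ω v y₀ + ∑ i, c (Sum.inl (Fin.succ i)) * p i v
          + (c (Sum.inr 0) * ω x₀ v + ∑ i, c (Sum.inr (Fin.succ i)) * q i v) = 0 := fun v => by
        have := LinearMap.congr_fun hc v
        simpa [Fin.sum_univ_succ, p₀, q₀] using this
      have e1 : c (Sum.inl 0) = 0 := by simpa [hx, h1, hω] using hc' x₀
      have e2 : c (Sum.inr 0) = 0 := by simpa [hy, h1, hω] using hc' y₀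
      have e3 := Fintype.linearIndependent_iff.1 hpq (c ∘ Sum.map Fin.succ Fin.succ) (by
        ext v
        simpa [e1, e2] using hc' v)
      rintro (i | i)
      · refine Fin.cases e1 (fun i => e3 (Sum.inl i)) i
      · refine Fin.cases e2 (fun i => e3 (Sum.inr i)) i
    · have := hsum x y
      rw [hω'] at this
      simp only [wedgeSum, Fin.sum_univ_succ, Fin.cons_zero, Fin.cons_succ] at this ⊢
      simp only [p₀, q₀, LinearMap.flip_apply]
      linear_combination this

theorem exists_dual_family [FiniteDimensional k V] {ι : Type*} [DecidableEq ι]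
    {f : ι → Module.Dual k V} (hf : LinearIndependent k f) :
    ∃ e : ι → V, ∀ s t, f s (e t) = if s = t then 1 else 0 := by
  choose Ψ hΨ using fun t => LinearMap.exists_extend (p := Submodule.span k (Set.range f))
    ((Finsupp.lapply (R := k) t : (ι →₀ k) →ₗ[k] k) ∘ₗ hf.repr)
  refine ⟨fun t => (Module.evalEquiv k V).symm (Ψ t), fun s t => ?_⟩
  have h := LinearMap.congr_fun (hΨ t) ⟨f s, Submodule.subset_span (Set.mem_range_self s)⟩
  have h' : hf.repr ⟨f s, Submodule.subset_span (Set.mem_range_self s)⟩ = Finsupp.single s 1 :=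
    hf.repr_eq_single s _ rfl
  rw [LinearMap.comp_apply, LinearMap.comp_apply, h', Finsupp.lapply_apply,
    Finsupp.single_apply] at h
  rw [Module.apply_evalEquiv_symm_apply]
  exact h

end Wedge

/-! ### Heisenberg structures -/

/-- Square-zero structures in which every left multiplication has rank at most one and square
zero. -/
structure IsHeisenberg {n : ℕ} (μ : AlgStr k n) : Prop where
  sq : ∀ x, μ x x = 0
  rank : ∀ x y y' (φ ψ : Module.Dual k (Fin n → k)),
    φ (μ x y) * ψ (μ x y') = φ (μ x y') * ψ (μ x y)
  nil : ∀ x y, μ x (μ x y) = 0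

theorem IsHeisenberg.of_mem_orbit {n : ℕ} {μ χ : AlgStr k n} (h : IsHeisenberg μ)
    (hχ : χ ∈ orbit μ) : IsHeisenberg χ := by
  obtain ⟨g, rfl⟩ := hχ
  refine ⟨fun x => ?_, fun x y y' φ ψ => ?_, fun x y => ?_⟩
  · simp [h.sq]
  · exact h.rank (g.symm x) (g.symm y) (g.symm y') (φ ∘ₗ g.toLinearMap) (ψ ∘ₗ g.toLinearMap)
  · simp [h.nil]

theorem degenerates.isHeisenberg {n : ℕ} {μ χ : AlgStr k n} (h : degenerates μ χ)
    (hμ : IsHeisenberg μ) : IsHeisenberg χ := by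
  refine ⟨fun x => funext fun i => ?_, fun x y y' φ ψ => ?_, fun x y => funext fun i => ?_⟩
  · refine h.eq_zero (.apply (LinearMap.proj i) x x) fun ν hν => ?_
    rw [(hμ.of_mem_orbit hν).sq, map_zero]
  · refine sub_eq_zero.1 (h.eq_zero (F := fun ν => φ (ν x y) * ψ (ν x y') - φ (ν x y') * ψ (ν x y))
      (.sub (.mul (.apply _ _ _) (.apply _ _ _)) (.mul (.apply _ _ _) (.apply _ _ _)))
      fun ν hν => ?_)
    exact sub_eq_zero.2 ((hμ.of_mem_orbit hν).rank x y y' φ ψ)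
  · have hexp : ∀ ν : AlgStr k n,
        ν x (ν x y) i = ∑ j, ν x y j * ν x (Pi.single j 1) i := fun ν => by
      conv_lhs => rw [pi_eq_sum_univ' (ν x y)]
      simp
    have hF : IsPolyFun fun ν : AlgStr k n => ∑ j, ν x y j * ν x (Pi.single j 1) i :=
      .sum _ fun j => .mul (.apply (LinearMap.proj j) x y) (.apply (LinearMap.proj i) x _)
    rw [hexp]
    refine h.eq_zero hF fun ν hν => ?_
    rw [← hexp, (hμ.of_mem_orbit hν).nil, Pi.zero_apply]

/-- `μ x y = (∑ i, p i ∧ q i) (x, y) • z` with independent functionals `p i`, `q i` vanishing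
at `z ≠ 0`. -/
structure HasForm {n l : ℕ} (μ : AlgStr k n) (z : Fin n → k)
    (p q : Fin l → Module.Dual k (Fin n → k)) : Prop where
  indep : LinearIndependent k (Sum.elim p q)
  ne_zero : z ≠ 0
  left : ∀ i, p i z = 0
  right : ∀ i, q i z = 0
  eq : ∀ x y, μ x y = wedgeSum p q x y • z

/-- `μ` is isomorphic to the Heisenberg algebra of rank `l` plus a trivial summand. -/
def IsForm {n : ℕ} (μ : AlgStr k n) (l : ℕ) : Prop :=
  ∃ (z : Fin n → k) (p q : Fin l → Module.Dual k (Fin n → k)), HasForm μ z p q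

theorem IsForm.isHeisenberg {n l : ℕ} {μ : AlgStr k n} (h : IsForm μ l) : IsHeisenberg μ := by
  obtain ⟨z, p, q, h⟩ := h
  refine ⟨fun x => ?_, fun x y y' φ ψ => ?_, fun x y => ?_⟩
  · simp [h.eq, wedgeSum, mul_comm]
  · simp only [h.eq, map_smul, smul_eq_mul]
    ring
  · simp [h.eq, wedgeSum, h.left, h.right]

theorem IsHeisenberg.exists_span {n : ℕ} {μ : AlgStr k n} (h : IsHeisenberg μ)
    {z₀ : Fin n → k} (hz₀ : z₀ ≠ 0) :
    ∃ (z : Fin n → k) (φ : Module.Dual k (Fin n → k)), z ≠ 0 ∧ φ z = 1 ∧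
      ∀ x y, μ x y = φ (μ x y) • z := by
  by_cases h0 : ∀ x y, μ x y = 0
  · obtain ⟨φ, hφ⟩ := Module.Projective.exists_dual_eq_one k hz₀
    exact ⟨z₀, φ, hz₀, hφ, fun x y => by simp [h0]⟩
  push Not at h0
  obtain ⟨a, b, hab⟩ := h0
  obtain ⟨φ, hφ⟩ := Module.Projective.exists_dual_eq_one k hab
  have hanti : ∀ x y, μ x y = -μ y x := fun x y => by
    have := h.sq (x + y)
    simp only [map_add, LinearMap.add_apply, h.sq] at this
    linear_combination (norm := module) this
  have key : ∀ x w (c : k), c ≠ 0 → μ x w = c • μ a b → ∀ y, μ x y = φ (μ x y) • μ a b := by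
    intro x w c hc hw y
    funext i
    have := h.rank x y w (LinearMap.proj i) φ
    simp only [hw, map_smul, hφ, LinearMap.proj_apply, smul_eq_mul, mul_one, Pi.smul_apply] at this ⊢
    apply mul_right_cancel₀ hc
    linear_combination this
  have ha := key a b 1 one_ne_zero (one_smul _ _).symm
  have hb := key b a (-1) (by simp) (by rw [hanti b a]; module)
  refine ⟨μ a b, φ, hab, hφ, fun x y => ?_⟩
  have hxb : μ x b = -φ (μ b x) • μ a b := by
    rw [hanti x b, hb x]
    simp [hφ]
  by_cases hc : -φ (μ b x) = 0
  · have := key (x + a) b 1 one_ne_zero (by simp [hxb, hc]) y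
    simp only [map_add, LinearMap.add_apply] at this
    linear_combination (norm := module) this - ha y
  · exact key x b _ hc hxb y

theorem IsHeisenberg.exists_isForm {n : ℕ} {μ : AlgStr k n} (h : IsHeisenberg μ)
    {z₀ : Fin n → k} (hz₀ : z₀ ≠ 0) : ∃ l, IsForm μ l := by
  obtain ⟨z, φ, hz, hφ, heq⟩ := h.exists_span hz₀
  obtain ⟨l, p, q, hpq, hω⟩ := exists_eq_wedgeSum _ (μ.compr₂ φ) (fun x => by simp [h.sq]) le_rfl
  have hxz : ∀ x, μ x z = 0 := fun x => by
    by_cases hx : ∀ y, φ (μ x y) = 0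
    · rw [heq, hx, zero_smul]
    push Not at hx
    obtain ⟨y, hy⟩ := hx
    have := h.nil x y
    rw [heq x y, map_smul] at this
    exact (smul_eq_zero.1 this).resolve_left hy
  have hzx : ∀ x, μ z x = 0 := fun x => by
    have := h.sq (x + z)
    simpa [h.sq, hxz] using this
  have hz' := wedgeSum_eq_zero hpq fun y => by rw [← hω, LinearMap.compr₂_apply, hzx, map_zero]
  exact ⟨l, z, p, q, hpq, hz, fun i => (hz' i).1, fun i => (hz' i).2, fun x y => by
    rw [← hω, LinearMap.compr₂_apply, ← heq]⟩

theorem IsForm.of_mem_orbit {n l : ℕ} {μ χ : AlgStr k n} (h : IsForm μ l) (hχ : χ ∈ orbit μ) :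
    IsForm χ l := by
  obtain ⟨z, p, q, h⟩ := h
  obtain ⟨g, rfl⟩ := hχ
  refine ⟨g z, fun i => p i ∘ₗ g.symm.toLinearMap, fun i => q i ∘ₗ g.symm.toLinearMap, ?_,
    by simpa using h.ne_zero, fun i => by simp [h.left], fun i => by simp [h.right],
    fun x y => by simp [h.eq, wedgeSum]⟩
  have e : (Sum.elim (fun i => p i ∘ₗ g.symm.toLinearMap) fun i => q i ∘ₗ g.symm.toLinearMap)
      = g.symm.dualMap.toLinearMap ∘ Sum.elim p q := by
    ext s : 1
    cases s <;> rfl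
  rw [e]
  exact h.indep.map' _ (LinearEquiv.ker _)

theorem HasForm.linearIndependent_sumElim {n l : ℕ} {μ : AlgStr k n} {z : Fin n → k}
    {p q : Fin l → Module.Dual k (Fin n → k)} (h : HasForm μ z p q)
    {ζ : Module.Dual k (Fin n → k)} (hζ : ζ z = 1) :
    LinearIndependent k (Sum.elim (Sum.elim p q) fun _ : Unit => ζ) := by
  have h' := Fintype.linearIndependent_iff.1 h.indep
  refine Fintype.linearIndependent_iff.2 fun c hc => ?_
  simp only [Fintype.sum_sum_type, Sum.elim_inl, Sum.elim_inr, Finset.univ_unique,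
    Finset.sum_singleton] at hc
  have h0 : c (Sum.inr ()) = 0 := by
    simpa [h.left, h.right, hζ] using LinearMap.congr_fun hc z
  have h1 := h' (c ∘ Sum.inl) (by simpa [h0] using hc)
  rintro (s | s)
  exacts [h1 s, h0]

theorem IsForm.le {n l : ℕ} {μ : AlgStr k n} (h : IsForm μ l) : 2 * l + 1 ≤ n := by
  obtain ⟨z, p, q, h⟩ := h
  obtain ⟨ζ, hζ⟩ := Module.Projective.exists_dual_eq_one k h.ne_zero
  have := (h.linearIndependent_sumElim hζ).fintype_card_le_finrank
  rw [Subspace.dual_finrank_eq] at this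
  simp at this
  omega

theorem IsForm.mem_orbit {n l : ℕ} {μ χ : AlgStr k n} (h : IsForm μ l) (h' : IsForm χ l) :
    χ ∈ orbit μ := by
  obtain ⟨z, p, q, h⟩ := h
  obtain ⟨z', p', q', h'⟩ := h'
  obtain ⟨ζ, hζ⟩ := Module.Projective.exists_dual_eq_one k h.ne_zero
  obtain ⟨ζ', hζ'⟩ := Module.Projective.exists_dual_eq_one k h'.ne_zero
  obtain ⟨g, hg⟩ := exists_linearEquiv_comp_eq (h.linearIndependent_sumElim hζ)
    (h'.linearIndependent_sumElim hζ')
  have hp : ∀ i x, p' i (g x) = p i x := fun i => hg (Sum.inl (Sum.inl i))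
  have hq : ∀ i x, q' i (g x) = q i x := fun i => hg (Sum.inl (Sum.inr i))
  have hgz : ζ' (g z) = 1 := (hg (Sum.inr ()) z).trans hζ
  let τ := LinearEquiv.transvection (f := ζ') (v := z' - g z) (by simp [hζ', hgz])
  have hτ : ∀ v, τ v = v + ζ' v • (z' - g z) := fun v => LinearEquiv.transvection.apply _ v
  refine mem_orbit_iff.2 ⟨g.trans τ, fun x y => ?_⟩
  have hp' : ∀ i x, p' i (τ (g x)) = p i x := fun i x => by simp [hτ, hp, h.left, h'.left]
  have hq' : ∀ i x, q' i (τ (g x)) = q i x := fun i x => by simp [hτ, hq, h.right, h'.right]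
  simp only [LinearEquiv.trans_apply, h.eq, h'.eq, map_smul, wedgeSum, hp', hq']
  rw [hτ (g z), hgz, one_smul, add_sub_cancel]

/-! ### Degenerations of Heisenberg structures -/

theorem HasForm.det_eq_zero {n l : ℕ} {μ : AlgStr k n} {z : Fin n → k}
    {p q : Fin l → Module.Dual k (Fin n → k)} (h : HasForm μ z p q)
    {ι : Type*} [Fintype ι] [DecidableEq ι] (hι : 2 * l < Fintype.card ι)
    (φ : Module.Dual k (Fin n → k)) (x y : ι → Fin n → k) :
    Matrix.det (Matrix.of fun s t => φ (μ (x s) (y t))) = 0 := by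
  by_contra hdet
  have e : (Matrix.of fun s t => φ (μ (x s) (y t)))
      = (Matrix.of fun s => Sum.elim (fun i => φ z * p i (x s)) fun i => -(φ z * q i (x s)))
        * (Matrix.of fun r t => Sum.elim q p r (y t)) := by
    ext s t
    simp only [Matrix.mul_apply, Matrix.of_apply, h.eq, map_smul, smul_eq_mul, wedgeSum,
      Fintype.sum_sum_type, Sum.elim_inl, Sum.elim_inr, ← Finset.sum_add_distrib, Finset.sum_mul]
    exact Finset.sum_congr rfl fun i _ => by ring
  have hr := Matrix.rank_of_isUnit _ ((Matrix.isUnit_iff_isUnit_det _).2 (Ne.isUnit hdet))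
  rw [e] at hr
  have h2 := hr.symm.trans_le ((Matrix.rank_mul_le_left _ _).trans (Matrix.rank_le_card_width _))
  simp only [Fintype.card_sum, Fintype.card_fin] at h2
  omega

theorem IsForm.le_of_degenerates {n l l' : ℕ} {μ χ : AlgStr k n} (h : IsForm μ l)
    (h' : IsForm χ l') (hdeg : degenerates μ χ) : l' ≤ l := by
  by_contra! hlt
  obtain ⟨z, p, q, h'⟩ := h'
  obtain ⟨φ, hφ⟩ := Module.Projective.exists_dual_eq_one k h'.ne_zero
  obtain ⟨e, he⟩ := exists_dual_family h'.indep
  let y : Fin l' ⊕ Fin l' → Fin n → k :=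
    Sum.elim (fun i => e (Sum.inr i)) fun i => -e (Sum.inl i)
  have h0 : Matrix.det (Matrix.of fun s t => φ (χ (e s) (y t))) = 0 := by
    refine hdeg.eq_zero (F := fun ν => Matrix.det (Matrix.of fun s t => φ (ν (e s) (y t))))
      (.det fun s t => .apply _ _ _) fun ν hν => ?_
    obtain ⟨_, _, _, hν⟩ := h.of_mem_orbit hν
    exact hν.det_eq_zero (by simp; omega) _ _ _
  have hp : ∀ i t, p i (e t) = if Sum.inl i = t then 1 else 0 := fun i t => he (Sum.inl i) t
  have hq : ∀ i t, q i (e t) = if Sum.inr i = t then 1 else 0 := fun i t => he (Sum.inr i) t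
  have h1 : (Matrix.of fun s t => φ (χ (e s) (y t))) = 1 := by
    ext s t
    rcases s with s | s <;> rcases t with t | t <;>
      simp [h'.eq, wedgeSum, hφ, y, hp, hq, Matrix.one_apply, eq_comm]
  rw [h1, Matrix.det_one] at h0
  exact one_ne_zero h0

theorem IsForm.exists_of_properlyDegenerates {n l : ℕ} {μ ν : AlgStr k n} (h : IsForm μ l)
    (hν : properlyDegenerates μ ν) : ∃ l' < l, IsForm ν l' := by
  obtain ⟨z, _, _, hz⟩ := id h
  obtain ⟨l', h'⟩ := (hν.1.isHeisenberg h.isHeisenberg).exists_isForm hz.ne_zero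
  refine ⟨l', lt_of_le_of_ne (h.le_of_degenerates h' hν.1) ?_, h'⟩
  rintro rfl
  exact hν.2 (h.mem_orbit h')

theorem IsForm.le_of_hasChain {n m : ℕ} :
    ∀ {μ : AlgStr k n} {l : ℕ}, IsForm μ l → hasChain μ m → m ≤ l := by
  induction m with
  | zero => exact fun _ _ => Nat.zero_le _
  | succ m ih =>
    intro μ l h hm
    obtain ⟨ν, hν, hm⟩ := hasChain_succ.1 hm
    obtain ⟨l', hl', h'⟩ := h.exists_of_properlyDegenerates hν
    exact (Nat.succ_le_succ (ih h' hm)).trans hl'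

/-- The structure `(∑ i, p i ∧ q i) ⊗ z`. -/
def wedgeStr {n l : ℕ} (p q : Fin l → Module.Dual k (Fin n → k)) (z : Fin n → k) : AlgStr k n :=
  ∑ i, ((LinearMap.mul k k).compl₁₂ (p i) (q i) - (LinearMap.mul k k).compl₁₂ (q i) (p i)).compr₂
    (LinearMap.toSpanSingleton k (Fin n → k) z)

@[simp]
theorem wedgeStr_apply {n l : ℕ} (p q : Fin l → Module.Dual k (Fin n → k)) (z x y : Fin n → k) :
    wedgeStr p q z x y = wedgeSum p q x y • z := by
  simp only [wedgeSum, Finset.sum_smul]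
  simp [wedgeStr, LinearMap.sum_apply]

theorem degenerates_of_add_smul [Infinite k] {n : ℕ} {μ α β : AlgStr k n}
    (h : ∀ t : k, t ≠ 0 → α + t • β ∈ orbit μ) : degenerates μ α := by
  refine degenerates_of_family
    (fun i => Polynomial.C (structConst α i) + Polynomial.C (structConst β i) * Polynomial.X)
    (fun t ht => ⟨_, h t ht, fun i => ?_⟩) fun i => by simp
  simp only [structConst, LinearMap.add_apply, LinearMap.smul_apply, Pi.add_apply, Pi.smul_apply,
    smul_eq_mul, Polynomial.eval_add, Polynomial.eval_mul, Polynomial.eval_C, Polynomial.eval_X]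
  ring

theorem IsForm.exists_properlyDegenerates [Infinite k] {n l : ℕ} {μ : AlgStr k n}
    (h : IsForm μ (l + 1)) : ∃ ν, properlyDegenerates μ ν ∧ IsForm ν l := by
  have hμ := h
  obtain ⟨z, p, q, h⟩ := h
  let α := wedgeStr (fun i => p (Fin.castSucc i)) (fun i => q (Fin.castSucc i)) z
  let β := wedgeStr (fun _ : Fin 1 => p (Fin.last l)) (fun _ => q (Fin.last l)) z
  have hα : IsForm α l := by
    refine ⟨z, _, _, ?_, h.ne_zero, fun i => h.left _, fun i => h.right _, wedgeStr_apply _ _ _⟩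
    have e : (Sum.elim (fun i => p (Fin.castSucc i)) fun i => q (Fin.castSucc i))
        = Sum.elim p q ∘ Sum.map Fin.castSucc Fin.castSucc := by
      ext s : 1
      cases s <;> rfl
    rw [e]
    exact h.indep.comp _ ((Fin.castSucc_injective l).sumMap (Fin.castSucc_injective l))
  have hdeg : degenerates μ α := by
    refine degenerates_of_add_smul (β := β) fun t ht => hμ.mem_orbit ?_
    let w : Fin (l + 1) → kˣ := fun i => if i = Fin.last l then Units.mk0 t ht else 1
    refine ⟨z, p, fun i => w i • q i, ?_, h.ne_zero, h.left, fun i => by simp [h.right],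
      fun x y => ?_⟩
    · have e : Sum.elim p (fun i => w i • q i)
          = (Sum.elim 1 w : Fin (l + 1) ⊕ Fin (l + 1) → kˣ) • Sum.elim p q := by
        ext s : 1
        cases s <;> simp
      rw [e]
      exact h.indep.units_smul _
    · simp only [α, β, LinearMap.add_apply, LinearMap.smul_apply, wedgeStr_apply, smul_smul,
        ← add_smul]
      congr 1
      simp [wedgeSum, Fin.sum_univ_castSucc, w, Fin.castSucc_ne_last, Units.smul_def]
      ring
  refine ⟨α, ⟨hdeg, fun hmem => ?_⟩, hα⟩
  have := hα.le_of_degenerates (hμ.of_mem_orbit hmem) fun T _ hT => hT (orbit_refl α)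
  omega

theorem IsForm.hasChain [Infinite k] {n : ℕ} {l : ℕ} :
    ∀ {μ : AlgStr k n}, IsForm μ l → hasChain μ l := by
  induction l with
  | zero => exact fun _ => hasChain_zero _
  | succ l ih =>
    intro μ h
    obtain ⟨ν, hν, h'⟩ := h.exists_properlyDegenerates
    exact hasChain_succ.2 ⟨ν, hν, ih h'⟩

theorem structConst_ofConst {n : ℕ} (c : Fin n → Fin n → Fin n → k) (i j m : Fin n) :
    structConst (ofConst c) (i, j, m) = c i j m := by
  simp [structConst, ofConst, LinearMap.sum_apply, Pi.single_apply, ite_apply]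

theorem isForm_etaStr {n l : ℕ} (hl : 2 * l + 1 ≤ n) : IsForm (etaStr n l : AlgStr k n) l := by
  let p : Fin l → Module.Dual k (Fin n → k) := fun i => LinearMap.proj ⟨2 * i, by omega⟩
  let q : Fin l → Module.Dual k (Fin n → k) := fun i => LinearMap.proj ⟨2 * i + 1, by omega⟩
  have hsum : ∀ i j : ℕ, (∑ s : Fin l, if 2 * (s : ℕ) = i ∧ 2 * (s : ℕ) + 1 = j then (1 : k) else 0)
      = if i % 2 = 0 ∧ j = i + 1 ∧ i < 2 * l then 1 else 0 := by
    intro i j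
    split_ifs with h
    · rw [Finset.sum_eq_single ⟨i / 2, by omega⟩]
      · rw [if_pos]
        simp only
        omega
      · intro s _ hs
        rw [if_neg]
        rintro ⟨h1, -⟩
        exact hs (Fin.ext (by simp only; omega))
      · simp
    · exact Finset.sum_eq_zero fun s _ => if_neg (by omega)
  refine ⟨unitVec n (2 * l), p, q, ?_, fun h => ?_, fun i => ?_, fun i => ?_, fun x y => ?_⟩
  · refine Fintype.linearIndependent_iff.2 fun c hc => ?_
    have hc' : ∀ v : Fin n → k, ∑ i, c (Sum.inl i) * v ⟨2 * i, by omega⟩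
        + ∑ i, c (Sum.inr i) * v ⟨2 * i + 1, by omega⟩ = 0 := fun v => by
      simpa [p, q] using LinearMap.congr_fun hc v
    rintro (i | i)
    · have := hc' (unitVec n (2 * i))
      simpa [unitVec, ← Fin.ext_iff, show ∀ a b : ℕ, 2 * a + 1 ≠ 2 * b by omega] using this
    · have := hc' (unitVec n (2 * i + 1))
      simpa [unitVec, ← Fin.ext_iff, show ∀ a b : ℕ, 2 * b ≠ 2 * a + 1 by omega] using this
  · simpa [unitVec] using congrFun h ⟨2 * l, by omega⟩
  · simp [p, unitVec]
    omega
  · simp [q, unitVec]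
    omega
  · suffices h : (etaStr n l : AlgStr k n) = wedgeStr p q (unitVec n (2 * l)) by
      rw [h, wedgeStr_apply]
    refine structConst_injective (funext fun ⟨i, j, m⟩ => ?_)
    rw [etaStr, structConst_ofConst]
    have e1 : wedgeSum p q (Pi.single i 1) (Pi.single j 1)
        = (if (i : ℕ) % 2 = 0 ∧ (j : ℕ) = i + 1 ∧ (i : ℕ) < 2 * l then 1 else 0)
          - if (j : ℕ) % 2 = 0 ∧ (i : ℕ) = j + 1 ∧ (j : ℕ) < 2 * l then 1 else 0 := by
      rw [← hsum, ← hsum, wedgeSum, ← Finset.sum_sub_distrib]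
      refine Finset.sum_congr rfl fun s _ => ?_
      simp [p, q, Pi.single_apply, Fin.ext_iff, ← ite_and, and_comm]
    simp only [structConst, wedgeStr_apply, e1, Pi.smul_apply, smul_eq_mul, unitVec]
    split_ifs <;> first | omega | simp

/-! ### Contractions with respect to a one-dimensional subalgebra -/

theorem degenerates_of_weights [Infinite k] {n : ℕ} {μ χ : AlgStr k n} (w : Fin n → ℕ)
    (h : ∀ i j m, structConst μ (i, j, m) ≠ 0 → w m ≤ w i + w j)
    (h0 : ∀ i j m, structConst χ (i, j, m)
      = if w m = w i + w j then structConst μ (i, j, m) else 0) : degenerates μ χ := by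
  refine degenerates_of_family (fun s => Polynomial.C (structConst μ s) *
    Polynomial.X ^ (w s.1 + w s.2.1 - w s.2.2)) (fun t ht => ?_) ?_
  · have ht' : ∀ i, (t ^ w i)⁻¹ ≠ 0 := fun i => inv_ne_zero (pow_ne_zero _ ht)
    let g : (Fin n → k) ≃ₗ[k] (Fin n → k) :=
      LinearEquiv.piCongrRight fun i => LinearEquiv.smulOfNeZero k k _ (ht' i)
    have hg : ∀ v i, g v i = (t ^ w i)⁻¹ * v i := fun v i => rfl
    have hgs : ∀ i, g.symm (Pi.single i 1) = t ^ w i • Pi.single i 1 := fun i => by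
      rw [g.symm_apply_eq]
      ext j
      rw [hg]
      by_cases hij : j = i
      · subst hij
        simp [ht]
      · simp [hij]
    refine ⟨_, transport_mem_orbit g μ, fun ⟨i, j, m⟩ => ?_⟩
    simp only [structConst, transport_apply, hgs, hg, map_smul, LinearMap.smul_apply, Pi.smul_apply,
      smul_eq_mul, Polynomial.eval_mul, Polynomial.eval_C, Polynomial.eval_pow, Polynomial.eval_X]
    by_cases hs : structConst μ (i, j, m) = 0
    · have hs' : μ (Pi.single i 1) (Pi.single j 1) m = 0 := hs
      simp [hs']
    · obtain ⟨d, hd⟩ := Nat.exists_eq_add_of_le (h i j m hs)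
      have hp : t ^ w i * t ^ w j = t ^ w m * t ^ d := by rw [← pow_add, hd, pow_add]
      rw [hd, Nat.add_sub_cancel_left, inv_mul_eq_iff_eq_mul₀ (pow_ne_zero _ ht)]
      linear_combination μ (Pi.single i 1) (Pi.single j 1) m * hp
  · rintro ⟨i, j, m⟩
    rw [h0]
    simp only [Polynomial.eval_mul, Polynomial.eval_C, Polynomial.eval_pow, Polynomial.eval_X]
    split_ifs with hw
    · simp [hw]
    · by_cases hs : structConst μ (i, j, m) = 0
      · simp [hs]
      · have := h i j m hs
        rw [zero_pow (by omega), mul_zero]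

theorem IWcontract0_apply {n : ℕ} (μ : AlgStr k n) (x y : Fin n → k) :
    IWcontract0 μ x y = projPos k n (μ (projPos k n x) (proj0 k n y))
      + projPos k n (μ (proj0 k n x) (projPos k n y)) + μ (proj0 k n x) (proj0 k n y) := rfl

theorem projPos_apply {n : ℕ} (x : Fin n → k) (i : Fin n) :
    projPos k n x i = if (i : ℕ) = 0 then 0 else x i := by
  simp only [projPos, LinearMap.pi_apply]
  split_ifs <;> rfl

theorem proj0_apply {n : ℕ} (x : Fin n → k) (i : Fin n) :
    proj0 k n x i = if (i : ℕ) = 0 then x i else 0 := by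
  simp only [proj0, LinearMap.pi_apply]
  split_ifs <;> rfl

theorem proj0_single {n : ℕ} (i : Fin n) :
    proj0 k n (Pi.single i 1) = if (i : ℕ) = 0 then Pi.single i 1 else 0 := by
  ext j
  rw [proj0_apply]
  by_cases hij : j = i
  · subst hij
    split_ifs <;> simp
  · split_ifs <;> simp [hij]

theorem projPos_single {n : ℕ} (i : Fin n) :
    projPos k n (Pi.single i 1) = if (i : ℕ) = 0 then 0 else Pi.single i 1 := by
  ext j
  rw [projPos_apply]
  by_cases hij : j = i
  · subst hij
    split_ifs <;> simp
  · split_ifs <;> simp [hij]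

theorem isHeisenberg_IWcontract0 [Infinite k] {n : ℕ} {χ : AlgStr k (n + 3)}
    (hsq : ∀ x, ∃ c : k, χ x x = c • x)
    (h01 : χ (Pi.single 0 1) (Pi.single 1 1) = Pi.single 2 1)
    (hchain : ¬ hasChain (IWcontract0 χ) 2) : IsHeisenberg (IWcontract0 χ) := by
  have hη : IsForm (etaStr (n + 3) 1 : AlgStr k (n + 3)) 1 := isForm_etaStr (by omega)
  suffices h : etaStr (n + 3) 1 ∈ orbit (IWcontract0 χ) from
    hη.isHeisenberg.of_mem_orbit (orbit_symm h)
  by_contra hmem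
  refine hchain (hasChain_succ.2 ⟨_, ⟨?_, hmem⟩, hη.hasChain⟩)
  obtain ⟨a, ha⟩ := hsq (Pi.single 0 1)
  obtain ⟨b, hb⟩ := hsq (Pi.single 1 1)
  have h10 := mul_add_mul_of_sq hsq (x := Pi.single 0 1) (y := Pi.single 1 1) (by
    rw [LinearIndependent.pair_iff]
    intro s t hst
    exact ⟨by simpa using congrFun hst 0, by simpa using congrFun hst 1⟩) ha hb
  rw [h01, ← eq_sub_iff_add_eq'] at h10
  let w : Fin (n + 3) → ℕ := fun i =>
    if (i : ℕ) = 0 then 2 else if (i : ℕ) = 1 then 0 else if (i : ℕ) = 2 then 2 else 1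
  have hw : ∀ i, w i ≤ 2 := fun i => by
    simp only [w]
    split_ifs <;> omega
  have hconst : ∀ i j m, structConst (IWcontract0 χ) (i, j, m)
      = if i = 0 then if j = 0 then if m = 0 then a else 0
          else if m = 0 then 0 else χ (Pi.single 0 1) (Pi.single j 1) m
        else if j = 0 then if m = 0 then 0 else χ (Pi.single i 1) (Pi.single 0 1) m else 0 := by
    intro i j m
    simp only [structConst, IWcontract0_apply, proj0_single, projPos_single, Fin.val_eq_zero_iff]
    by_cases hi : i = 0 <;> by_cases hj : j = 0 <;>
      simp [hi, hj, projPos_apply, ha, Pi.single_apply]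
  refine degenerates_of_weights w (fun i j m hs => ?_) fun i j m => ?_
  · by_cases hi : i = 0
    · have : w i = 2 := by simp [w, hi]
      have := hw m
      omega
    · by_cases hj : j = 0
      · have : w j = 2 := by simp [w, hj]
        have := hw m
        omega
      · exact absurd (by simp [hconst, hi, hj]) hs
  · rw [hconst, etaStr, structConst_ofConst]
    have hv1 : ∀ i : Fin (n + 3), i ≠ 1 → (i : ℕ) ≠ 1 := fun i hi h => hi (Fin.ext h)
    have hw1 : ∀ i, i ≠ 1 → w i ≠ 0 := fun i hi => by
      have := hv1 i hi
      simp only [w]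
      split_ifs <;> omega
    have hw2 : ∀ i, w i = 2 ↔ i = 0 ∨ i = 2 := fun i => by
      simp only [w, Fin.ext_iff, Fin.val_zero, Fin.val_two]
      split_ifs <;> simp [*]
    have hm2 : (m : ℕ) = 2 ↔ m = 2 := by rw [Fin.ext_iff, Fin.val_two]
    have w0 : w 0 = 2 := rfl
    have w1 : w 1 = 0 := rfl
    have := hw m
    by_cases hi : i = 0
    · subst hi
      by_cases hj : j = 1
      · subst hj
        by_cases hm0 : m = 0
        · subst hm0
          simp
        · simp [w0, w1, hw2, hm0, h01, Pi.single_apply, hm2]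
      · have := hw1 j hj
        rw [if_neg (c := w m = _) (by omega), if_neg (by have := hv1 j hj; simp [this]),
          if_neg (by simp)]
    · by_cases hj : j = 0
      · subst hj
        by_cases hi1 : i = 1
        · subst hi1
          by_cases hm0 : m = 0
          · subst hm0
            simp
          · by_cases hm1 : m = 1
            · subst hm1
              simp [w0, w1]
            · simp [w0, w1, hw2, hm0, h10, Pi.single_apply, hm2, hm1]
              split_ifs <;> simp
        · have := hw1 i hi1
          rw [if_neg (c := w m = _) (by omega), if_neg (by simp),
            if_neg (by have := hv1 i hi1; simp [this])]
      · have hi' := Fin.val_ne_zero_iff.2 hi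
        have hj' := Fin.val_ne_zero_iff.2 hj
        rw [if_neg (by omega), if_neg (by omega)]
        simp [hi, hj]

theorem IWcontract0_single_zero {n : ℕ} (χ : AlgStr k (n + 1))
    (h0 : χ (Pi.single 0 1) (Pi.single 0 1) = 0) (y : Fin (n + 1) → k) :
    IWcontract0 χ (Pi.single 0 1) y
      = χ (Pi.single 0 1) y - χ (Pi.single 0 1) y 0 • Pi.single 0 1 := by
  have hy : y = y 0 • Pi.single 0 1 + projPos k (n + 1) y := by
    ext i
    simp only [Pi.add_apply, Pi.smul_apply, projPos_apply, Fin.val_eq_zero_iff]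
    split_ifs with hi <;> simp [hi]
  have hy0 : proj0 k (n + 1) y = y 0 • Pi.single 0 1 := by
    ext i
    simp only [Pi.smul_apply, proj0_apply, Fin.val_eq_zero_iff]
    split_ifs with hi <;> simp [hi]
  have h1 : χ (Pi.single 0 1) y = χ (Pi.single 0 1) (projPos k (n + 1) y) := by
    conv_lhs => rw [hy]
    simp [h0]
  rw [IWcontract0_apply, proj0_single, projPos_single, hy0, h1]
  simp only [Fin.val_zero, if_true, map_smul, h0, smul_zero, map_zero, LinearMap.zero_apply,
    zero_add, add_zero]
  ext i
  simp only [Pi.sub_apply, Pi.smul_apply, projPos_apply, Fin.val_eq_zero_iff]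
  split_ifs with hi <;> simp [hi]

theorem mul_left_of_not_isScalarAt [Infinite k] {n : ℕ} {μ : AlgStr k n}
    (hsq : ∀ x, ∃ c : k, μ x x = c • x)
    (hIW : ∀ χ ∈ orbit μ,
      χ (unitVec n 0) (unitVec n 0) ∈ Submodule.span k {unitVec n 0} →
      ¬ hasChain (IWcontract0 χ) 2) {a : Fin n → k} (ha : ¬ IsScalarAt μ a) :
    μ a a = 0 ∧ ∃ v, (∀ y, ∃ α β : k, μ a y = α • a + β • μ a v) ∧ ∃ s : k, μ a (μ a v) = s • a := by
  obtain ⟨v, hv⟩ := exists_linearIndependent_of_not_isScalarAt hsq ha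
  obtain ⟨n, rfl⟩ : ∃ n', n = n' + 3 := by
    have := hv.fintype_card_le_finrank
    simp only [Fintype.card_fin, Module.finrank_fin_fun] at this
    exact ⟨n - 3, by omega⟩
  have h02 : (0 : Fin (n + 3)) ≠ 2 := by
    simp [Fin.ext_iff, Nat.mod_eq_of_lt (show 2 < n + 3 by omega)]
  have h12 : (1 : Fin (n + 3)) ≠ 2 := by
    simp [Fin.ext_iff, Nat.mod_eq_of_lt (show 2 < n + 3 by omega)]
  obtain ⟨g, hg⟩ := exists_linearEquiv_apply_eq hv
    (v := ![Pi.single 0 1, Pi.single 1 1, Pi.single 2 1]) (by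
      rw [Fintype.linearIndependent_iff]
      intro c hc i
      simp only [Fin.sum_univ_three] at hc
      have h0 := congrFun hc 0
      have h1 := congrFun hc 1
      have h2 := congrFun hc 2
      fin_cases i
      · simpa [Pi.single_apply, h02, h12, h02.symm, h12.symm] using h0
      · simpa [Pi.single_apply, h02, h12, h02.symm, h12.symm] using h1
      · simpa [Pi.single_apply, h02, h12, h02.symm, h12.symm] using h2)
  have hga : g a = Pi.single 0 1 := hg 0
  have hgv : g v = Pi.single 1 1 := hg 1
  have hgav : g (μ a v) = Pi.single 2 1 := hg 2
  obtain ⟨χ, hχ, hmul⟩ : ∃ χ ∈ orbit μ, ∀ x y, g (μ x y) = χ (g x) (g y) :=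
    ⟨_, transport_mem_orbit g μ, fun x y => by simp⟩
  have hχsq : ∀ x, ∃ c : k, χ x x = c • x := fun x => by
    obtain ⟨c, hc⟩ := hsq (g.symm x)
    refine ⟨c, ?_⟩
    have := hmul (g.symm x) (g.symm x)
    rw [hc, map_smul] at this
    simpa using this.symm
  have h01 : χ (Pi.single 0 1) (Pi.single 1 1) = Pi.single 2 1 := by
    rw [← hga, ← hgv, ← hmul, hgav]
  have hT := isHeisenberg_IWcontract0 hχsq h01 (hIW χ hχ (by
    obtain ⟨c, hc⟩ := hχsq (unitVec (n + 3) 0)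
    exact Submodule.mem_span_singleton.2 ⟨c, hc.symm⟩))
  have h00 : χ (Pi.single 0 1) (Pi.single 0 1) = 0 := by
    have := hT.sq (Pi.single 0 1)
    rw [IWcontract0_apply, proj0_single, projPos_single] at this
    simpa using this
  have hT0 := IWcontract0_single_zero χ h00
  have hT1 : IWcontract0 χ (Pi.single 0 1) (Pi.single 1 1) = Pi.single 2 1 := by
    rw [hT0, h01]
    simp [h02]
  refine ⟨g.injective (by rw [hmul, hga, h00, map_zero]), v, fun y => ?_, ?_⟩
  · refine ⟨χ (Pi.single 0 1) (g y) 0, IWcontract0 χ (Pi.single 0 1) (g y) 2, g.injective ?_⟩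
    have h1 : IWcontract0 χ (Pi.single 0 1) (g y)
        = IWcontract0 χ (Pi.single 0 1) (g y) 2 • Pi.single 2 1 := by
      ext i
      have := hT.rank (Pi.single 0 1) (g y) (Pi.single 1 1) (LinearMap.proj i) (LinearMap.proj 2)
      rw [hT1] at this
      simpa [mul_comm] using this
    rw [map_add, map_smul, map_smul, hgav, hga, hmul, hga, ← h1, hT0]
    abel
  · have h2 := hT.nil (Pi.single 0 1) (Pi.single 1 1)
    rw [hT1, hT0, sub_eq_zero] at h2
    exact ⟨_, g.injective (by rw [hmul, hgav, hga, map_smul, hga, h2])⟩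

theorem eq_zero_of_forall_cubic [Infinite k] {a b c d : k}
    (h : ∀ t : k, t ≠ 0 → a + t * b + t ^ 2 * c + t ^ 3 * d = 0) : a = 0 := by
  open Polynomial in
  let p : k[X] := C a + C b * X + C c * X ^ 2 + C d * X ^ 3
  have hp : p = 0 := Polynomial.eq_zero_of_infinite_isRoot p <|
    (Set.finite_singleton (0 : k)).infinite_compl.mono fun t ht => by
      simpa [p, Polynomial.IsRoot, mul_comm t, mul_comm (t ^ _)] using h t ht
  simpa [p] using congrArg (Polynomial.eval 0) hp

theorem eq_zero_of_forall_smul_cubic [Infinite k] {n : ℕ} {a b c d : Fin n → k}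
    (h : ∀ t : k, t ≠ 0 → a + t • b + t ^ 2 • c + t ^ 3 • d = 0) : a = 0 := by
  ext i
  exact eq_zero_of_forall_cubic fun t ht => congrFun (h t ht) i

theorem isHeisenberg_of_span_ne_top [Infinite k] {n : ℕ} {μ : AlgStr k n}
    (hsq : ∀ x, ∃ c : k, μ x x = c • x) (hspan : Submodule.span k {a | IsScalarAt μ a} ≠ ⊤)
    (hIW : ∀ χ ∈ orbit μ,
      χ (unitVec n 0) (unitVec n 0) ∈ Submodule.span k {unitVec n 0} →
      ¬ hasChain (IWcontract0 χ) 2) : IsHeisenberg μ := by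
  set W := Submodule.span k {a | IsScalarAt μ a}
  obtain ⟨w, hw⟩ : ∃ w, w ∉ W := by
    by_contra! H
    exact hspan (eq_top_iff.2 fun x _ => H x)
  have hbad : ∀ x, x ∉ W → ¬ IsScalarAt μ x := fun x hx h => hx (Submodule.subset_span h)
  have hline : ∀ x ∈ W, ∀ t : k, t ≠ 0 → x + t • w ∉ W := fun x hx t ht h =>
    hw ((W.smul_mem_iff ht).1 ((W.add_mem_iff_right hx).1 h))
  have hxx : ∀ x, μ x x = 0 := by
    intro x
    by_cases hx : x ∈ W
    · refine eq_zero_of_forall_smul_cubic (b := μ x w + μ w x) (c := μ w w) (d := 0)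
        fun t ht => ?_
      have := (mul_left_of_not_isScalarAt hsq hIW (hbad _ (hline x hx t ht))).1
      simp only [map_add, map_smul, LinearMap.add_apply, LinearMap.smul_apply] at this
      linear_combination (norm := module) this
    · exact (mul_left_of_not_isScalarAt hsq hIW (hbad x hx)).1
  have hanti : ∀ x y, μ y x = - μ x y := fun x y => by
    have := hxx (x + y)
    simp only [map_add, LinearMap.add_apply, hxx, zero_add, add_zero] at this
    exact eq_neg_of_add_eq_zero_left this
  have hcube : ∀ x y, μ x (μ x (μ x y)) = 0 := by
    have key : ∀ x, x ∉ W → ∀ y, μ x (μ x (μ x y)) = 0 := by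
      intro x hx y
      obtain ⟨h0, v, hv, s, hs⟩ := mul_left_of_not_isScalarAt hsq hIW (hbad x hx)
      obtain ⟨α, β, hy⟩ := hv y
      simp [hy, h0, hs]
    intro x y
    by_cases hx : x ∈ W
    · refine eq_zero_of_forall_smul_cubic
        (b := μ x (μ x (μ w y)) + μ x (μ w (μ x y)) + μ w (μ x (μ x y)))
        (c := μ x (μ w (μ w y)) + μ w (μ x (μ w y)) + μ w (μ w (μ x y)))
        (d := μ w (μ w (μ w y))) fun t ht => ?_
      have := key _ (hline x hx t ht) y
      simp only [map_add, map_smul, LinearMap.add_apply, LinearMap.smul_apply] at this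
      linear_combination (norm := module) this
    · exact key x hx y
  have hspanzero : ∀ x y (s t : k), μ x y = s • x + t • y → μ x y = 0 := by
    intro x y s t h
    rcases eq_or_ne t 0 with rfl | ht
    · rw [zero_smul, add_zero] at h
      have h' : μ y x = (-s) • x := by rw [hanti x y, h, neg_smul]
      have := hcube y x
      simp only [h', map_smul, smul_smul, smul_eq_zero, mul_eq_zero, neg_eq_zero, or_self] at this
      rcases this with hs | hx
      · rw [h, hs, zero_smul]
      · rw [h, hx, smul_zero]
    · have h1 : μ x (μ x y) = t • μ x y := by
        conv_lhs => rw [h]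
        simp [hxx]
      have := hcube x y
      rw [h1, map_smul, h1, smul_smul] at this
      exact (smul_eq_zero.1 this).resolve_left (mul_ne_zero ht ht)
  have hnil : ∀ x y, μ x (μ x y) = 0 := by
    have key : ∀ x, x ∉ W → ∀ y, μ x (μ x y) = 0 := by
      intro x hx y
      obtain ⟨h0, v, hv, s, hs⟩ := mul_left_of_not_isScalarAt hsq hIW (hbad x hx)
      obtain ⟨α, β, hy⟩ := hv y
      refine hspanzero x (μ x y) (β * s) 0 ?_
      rw [hy]
      simp [h0, hs, smul_smul]
    intro x y
    by_cases hx : x ∈ W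
    · refine eq_zero_of_forall_smul_cubic (b := μ x (μ w y) + μ w (μ x y)) (c := μ w (μ w y))
        (d := 0) fun t ht => ?_
      have := key _ (hline x hx t ht) y
      simp only [map_add, map_smul, LinearMap.add_apply, LinearMap.smul_apply] at this
      linear_combination (norm := module) this
    · exact key x hx y
  refine ⟨hxx, ?_, hnil⟩
  have key : ∀ x, x ∉ W → ∀ y y' (φ ψ : Module.Dual k (Fin n → k)),
      φ (μ x y) * ψ (μ x y') = φ (μ x y') * ψ (μ x y) := by
    intro x hx y y' φ ψ
    obtain ⟨h0, v, hv, -⟩ := mul_left_of_not_isScalarAt hsq hIW (hbad x hx)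
    have hmul : ∀ y, ∃ β : k, μ x y = β • μ x v := by
      intro y
      obtain ⟨α, β, hy⟩ := hv y
      refine ⟨β, sub_eq_zero.1 ?_⟩
      rw [← map_smul, ← map_sub]
      exact hspanzero x (y - β • v) α 0 (by simp [hy])
    obtain ⟨β, hβ⟩ := hmul y
    obtain ⟨β', hβ'⟩ := hmul y'
    simp only [hβ, hβ', map_smul, smul_eq_mul]
    ring
  intro x y y' φ ψ
  by_cases hx : x ∈ W
  · refine sub_eq_zero.1 (eq_zero_of_forall_cubic
      (b := φ (μ x y) * ψ (μ w y') + φ (μ w y) * ψ (μ x y')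
        - (φ (μ x y') * ψ (μ w y) + φ (μ w y') * ψ (μ x y)))
      (c := φ (μ w y) * ψ (μ w y') - φ (μ w y') * ψ (μ w y)) (d := 0) fun t ht => ?_)
    have := key _ (hline x hx t ht) y y' φ ψ
    simp only [map_add, map_smul, LinearMap.add_apply, LinearMap.smul_apply, smul_eq_mul] at this
    linear_combination this
  · exact key x hx y y' φ ψ

/-! ## STATEMENT 12 -/
theorem stmt12 {k : Type*} [Field k] [IsAlgClosed k] (n m : ℕ) (hm : 2 < m)
    (μ : AlgStr k n) (hlev : levelIs μ m) (hG : genType μ 1)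
    (hIW : ∀ χ ∈ orbit μ,
      χ (unitVec n 0) (unitVec n 0) ∈ Submodule.span k {unitVec n 0} →
      ¬ hasChain (IWcontract0 χ) 2) :
    2 * m + 1 ≤ n ∧ μ ∈ orbit (etaStr n m) := by
  have hsq := exists_sq_eq_smul_of_genType hG
  have hspan : Submodule.span k {a | IsScalarAt μ a} ≠ ⊤ := fun h => by
    obtain ⟨p, rfl⟩ := exists_formStr_of_span_eq_top hsq h
    exact not_hasChain_three_formStr p (hasChain_mono hm hlev.1)
  have hμ := isHeisenberg_of_span_ne_top hsq hspan hIW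
  obtain ⟨z, -, hz⟩ : ∃ z ∈ (⊤ : Submodule k (Fin n → k)), z ≠ 0 := by
    refine (Submodule.ne_bot_iff _).1 fun h => hspan ?_
    exact (subsingleton_of_bot_eq_top h.symm).elim _ _
  obtain ⟨l, hl⟩ := hμ.exists_isForm hz
  obtain rfl : m = l := by
    refine le_antisymm (hl.le_of_hasChain hlev.1) (not_lt.1 fun h => hlev.2 ?_)
    exact hasChain_mono h hl.hasChain
  exact ⟨hl.le, (isForm_etaStr hl.le).mem_orbit hl⟩

end
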